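/- arXiv:math/0612782 — 3 statements merged into one kernel-verified Lean document; each statement's English description precedes it below -/
import Mathlib

section
/- Let d, d₁ be integers with 1 ≤ d₁ < d. There exists a constant C > 0 (depending only on d and d₁) such that for every integer n ≥ 1, the number S_n of marked admissible proper systems with parameters m = n(2d − d₁) and σ(i) = min(n d₁ + i, m − i), consisting of exactly 2nd − 1 intervals, satisfies log S_n ≥ (4d − d₁) n log n − C n. -/
/-- `IsProperSystem m σ S` : `S` is a *proper system* with parameters `(m, σ)`, i.e. a finite
multiset of closed intervals `[a,b]` with integer endpoints (encoded as pairs `(a,b)` of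
integers, one-point intervals `a = b` allowed) contained in `[0,m]`, such that for every
integer `i ∈ [0,m]` the number of intervals of `S` containing `i`, counted with multiplicity,
equals `σ i`. -/
def IsProperSystem (m : ℤ) (σ : ℤ → ℕ) (S : Multiset (ℤ × ℤ)) : Prop :=
  (∀ I ∈ S, 0 ≤ I.1 ∧ I.1 ≤ I.2 ∧ I.2 ≤ m) ∧
  ∀ i : ℤ, 0 ≤ i → i ≤ m →
    (S.filter fun I => I.1 ≤ i ∧ i ≤ I.2).card = σ i

/-- The *graph* of a system of intervals in `[0,m]` enumerated (with multiplicity) by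
`f : Fin t → ℤ × ℤ` : its vertices are the `t` intervals (`Sum.inl j` is the `j`-th interval)
together with `m` additional vertices `w_0, …, w_{m-1}` (`Sum.inr i` is `w_i`), and `w_i` is
adjacent exactly to the intervals whose right endpoint is `i` and to the intervals whose
left endpoint is `i + 1`. -/
def systemGraph (m : ℕ) {t : ℕ} (f : Fin t → ℤ × ℤ) : SimpleGraph (Fin t ⊕ Fin m) :=
  SimpleGraph.fromRel fun u v =>
    match u, v with
    | Sum.inl j, Sum.inr i => (f j).2 = (i : ℤ) ∨ (f j).1 = (i : ℤ) + 1
    | _, _ => False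

/-- A multiset of intervals in `[0,m]` is *admissible* if its graph is a tree.  (The graph is
independent, up to isomorphism, of the chosen enumeration of the multiset.) -/
def IsAdmissible (m : ℕ) (S : Multiset (ℤ × ℤ)) : Prop :=
  ∃ (t : ℕ) (f : Fin t → ℤ × ℤ), (List.ofFn f : Multiset (ℤ × ℤ)) = S ∧
    (systemGraph m f).IsTree

/-- `IsMarkedSystem m σ t M` : `M` is a *marked admissible proper system* with parameters
`(m, σ)` consisting of exactly `t` intervals: a finite multiset of pairs `(I, p)` where `p`
is an integer point of the interval `I`, whose multiset of first components is an admissible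
proper system with parameters `(m, σ)` consisting of `t` intervals. -/
def IsMarkedSystem (m : ℕ) (σ : ℤ → ℕ) (t : ℕ) (M : Multiset ((ℤ × ℤ) × ℤ)) : Prop :=
  (∀ p ∈ M, p.1.1 ≤ p.2 ∧ p.2 ≤ p.1.2) ∧
  IsProperSystem m σ (M.map Prod.fst) ∧
  IsAdmissible m (M.map Prod.fst) ∧
  M.card = t

namespace S2

theorem isTree_of_parent {X Y : Type*} [Finite X] (G : SimpleGraph X) (φ : Y ≃ X) (r : Y)
    (par : Y → Y) (rk : Y → ℕ)
    (h1 : ∀ y, y ≠ r → G.Adj (φ y) (φ (par y)) ∧ rk (par y) < rk y)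
    (h2 : ∀ x y, G.Adj (φ x) (φ y) → (x ≠ r ∧ y = par x) ∨ (y ≠ r ∧ x = par y)) :
    G.IsTree := by
  classical
  have hreach : ∀ k, ∀ y, rk y = k → G.Reachable (φ y) (φ r) := by
    intro k
    induction k using Nat.strong_induction_on with
    | _ k ih =>
      intro y hy
      by_cases hr : y = r
      · rw [hr]
      · obtain ⟨ha, hb⟩ := h1 y hr
        exact ha.reachable.trans (ih _ (hy ▸ hb) _ rfl)
  have hconn : G.Connected := by
    have : Nonempty X := ⟨φ r⟩
    refine SimpleGraph.Connected.mk ?_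
    intro a b
    have ha := hreach _ (φ.symm a) rfl
    have hb := hreach _ (φ.symm b) rfl
    simp only [Equiv.apply_symm_apply] at ha hb
    exact ha.trans hb.symm
  rw [SimpleGraph.isTree_iff_connected_and_card]
  refine ⟨hconn, le_antisymm ?_ ?_⟩
  · have : Finite Y := Finite.of_equiv _ φ.symm
    have hle : Nat.card G.edgeSet ≤ Nat.card {y : Y // y ≠ r} := by
      refine Nat.card_le_card_of_surjective
        (fun y => (⟨s(φ y.1, φ (par y.1)), (h1 y.1 y.2).1⟩ : G.edgeSet)) ?_
      rintro ⟨e, he⟩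
      induction e using Sym2.ind with
      | _ a b =>
        have hab : G.Adj (φ (φ.symm a)) (φ (φ.symm b)) := by simpa using he
        rcases h2 _ _ hab with ⟨hx, hy⟩ | ⟨hx, hy⟩
        · refine ⟨⟨_, hx⟩, ?_⟩
          simp [← hy]
        · refine ⟨⟨_, hx⟩, ?_⟩
          simp [← hy, Sym2.eq_swap]
    have hc : Nat.card {y : Y // y ≠ r} + 1 = Nat.card X := by
      rw [← Nat.card_congr φ]
      have := Fintype.ofFinite Y
      have h3 := Fintype.card_subtype_compl (fun y : Y => y = r)
      simp only [Fintype.card_subtype_eq] at h3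
      have h4 : 0 < Fintype.card Y := Fintype.card_pos_iff.2 ⟨r⟩
      simp only [Nat.card_eq_fintype_card]
      have h5 : Fintype.card {y : Y // y ≠ r} = Fintype.card {y : Y // ¬ y = r} := rfl
      omega
    omega
  · exact hconn.card_vert_le_card_edgeSet_add_one

theorem markedFinite (m t : ℕ) (P : Multiset ((ℤ × ℤ) × ℤ) → Prop)
    (hP : ∀ M, P M → M.card = t ∧ ∀ p ∈ M, 0 ≤ p.1.1 ∧ p.1.1 ≤ p.2 ∧ p.2 ≤ p.1.2 ∧ p.1.2 ≤ m) :
    {M | P M}.Finite := by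
  classical
  let box : Finset ((ℤ × ℤ) × ℤ) :=
    (Finset.Icc 0 (m:ℤ) ×ˢ Finset.Icc 0 (m:ℤ)) ×ˢ Finset.Icc 0 (m:ℤ)
  refine (Set.finite_Iic (t • box.val)).subset ?_
  intro M hM
  obtain ⟨hc, hb⟩ := hP M hM
  rw [Set.mem_Iic, Multiset.le_iff_count]
  intro a
  by_cases ha : a ∈ M
  · have : a ∈ box := by
      have := hb a ha
      simp only [box, Finset.mem_product, Finset.mem_Icc]
      omega
    rw [Multiset.count_nsmul, Multiset.count_eq_one_of_mem box.nodup this]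
    have := Multiset.count_le_card a M
    omega
  · rw [Multiset.count_eq_zero_of_notMem ha]; exact Nat.zero_le _

end S2
namespace S2

/-- Block of the lower endpoint of the edge owned by a vertex of block `k`. -/
def lob (L k : ℕ) : ℕ := if k < L then k else if k = L then 0 else if k ≤ 2 * L then L else k - 1
/-- Block of the upper endpoint of the edge owned by a vertex of block `k`. -/
def hib (L k : ℕ) : ℕ := if k < L then L else k
/-- Block of the parent of a vertex of block `k`. -/
def pb (L k : ℕ) : ℕ := if k < L then L else lob L k
/-- Block of pendant class `q`. -/
def pq (L q : ℕ) : ℕ := if q = 0 then 0 else 2 * L + q - 1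
/-- Position of the parent. -/
def ps {n : ℕ} [NeZero n] (k : ℕ) (s : Fin n) : Fin n := if k = 0 then s - 1 else s

/-- The label of the vertex at position `s` of block `k`. -/
def lab {n : ℕ} (g : ℕ → Equiv.Perm (Fin n)) (k : ℕ) (s : Fin n) : ℕ := n * k + (g k s).val

theorem lab_block {n : ℕ} (g g' : ℕ → Equiv.Perm (Fin n)) {k k' : ℕ} {s s' : Fin n}
    (h : lab g k s = lab g' k' s') : k = k' := by
  have hn : 0 < n := Nat.pos_of_ne_zero (by rintro rfl; exact s.elim0)
  have h1 : lab g k s / n = k := by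
    unfold lab; rw [Nat.mul_add_div hn, Nat.div_eq_of_lt (g k s).2, add_zero]
  have h2 : lab g' k' s' / n = k' := by
    unfold lab; rw [Nat.mul_add_div hn, Nat.div_eq_of_lt (g' k' s').2, add_zero]
  rw [← h1, ← h2, h]

theorem lab_inj {n : ℕ} (g : ℕ → Equiv.Perm (Fin n)) {k k' : ℕ} {s s' : Fin n}
    (h : lab g k s = lab g k' s') : k = k' ∧ s = s' := by
  have hk := lab_block g g h
  subst hk
  refine ⟨rfl, ?_⟩
  unfold lab at h
  exact (g k).injective (Fin.ext (by omega))

theorem lab_lt {n : ℕ} (g : ℕ → Equiv.Perm (Fin n)) {k k' : ℕ} (s s' : Fin n)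
    (h : k < k') : lab g k s + (g k' s').val + 1 ≤ lab g k' s' := by
  unfold lab
  have h1 := (g k s).2
  have h2 : n * (k + 1) ≤ n * k' := Nat.mul_le_mul_left _ h
  rw [Nat.mul_add] at h2
  omega

theorem lab_bound {n K : ℕ} (g : ℕ → Equiv.Perm (Fin n)) {k : ℕ} (s : Fin n)
    (h : k < K) : lab g k s < n * K := by
  unfold lab
  have h1 := (g k s).2
  have h2 : n * (k + 1) ≤ n * K := Nat.mul_le_mul_left _ h
  rw [Nat.mul_add] at h2
  omega

theorem lob_lt_hib {L k : ℕ} (hL : 1 ≤ L) : lob L k < hib L k := by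
  unfold lob hib; split_ifs <;> omega

theorem lob_lt {L k K : ℕ} (hL : 1 ≤ L) (hK : 2 * L < K) (hk : k < K) : lob L k < K := by
  unfold lob; split_ifs <;> omega
theorem hib_lt {L k K : ℕ} (hK : 2 * L < K) (hk : k < K) : hib L k < K := by
  unfold hib; split_ifs <;> omega
theorem pb_lt {L k K : ℕ} (hK : 2 * L < K) (hk : k < K) : pb L k < K := by
  unfold pb lob; split_ifs <;> omega
theorem pq_lt {L d₁ q : ℕ} (hd : 1 ≤ d₁) (hq : q < d₁) : pq L q < 2 * L + d₁ := by
  unfold pq; split_ifs <;> omega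

/-- Labels as an equivalence. -/
noncomputable def labEquiv {n : ℕ} (K : ℕ) (g : ℕ → Equiv.Perm (Fin n)) :
    Fin K × Fin n ≃ Fin (n * K) :=
  Equiv.ofBijective (fun v => (⟨lab g v.1 v.2, lab_bound g v.2 v.1.2⟩ : Fin (n * K))) <| by
    rw [Fintype.bijective_iff_injective_and_card]
    constructor
    · rintro ⟨k, s⟩ ⟨k', s'⟩ h
      have := lab_inj g (Fin.mk.inj_iff.1 h)
      exact Prod.ext (Fin.ext this.1) this.2
    · simp [mul_comm]

theorem labEquiv_val {n : ℕ} (K : ℕ) (g : ℕ → Equiv.Perm (Fin n)) (v : Fin K × Fin n) :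
    (labEquiv K g v).val = lab g v.1 v.2 := rfl

/-- Index type of intervals, with one superfluous element. -/
abbrev J0 (L d₁ n : ℕ) := (Fin (2 * L + d₁) × Fin n) ⊕ (Fin d₁ × Fin n)

/-- The intervals. -/
def iv {L d₁ n : ℕ} [NeZero n] (g : ℕ → Equiv.Perm (Fin n)) : J0 L d₁ n → ℤ × ℤ
  | Sum.inl v => (if v.1.val = 0 ∧ v.2 = 0 then 0 else (lab g (lob L v.1) v.2 : ℤ) + 1,
      (lab g (hib L v.1) (ps v.1 v.2) : ℤ))
  | Sum.inr v => (0, (lab g (pq L v.1) v.2 : ℤ))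

/-- Position of the upper endpoint. -/
def hp {L d₁ n : ℕ} [NeZero n] (g : ℕ → Equiv.Perm (Fin n)) : J0 L d₁ n → ℕ
  | Sum.inl v => (g (hib L v.1) (ps v.1 v.2)).val
  | Sum.inr v => (g (pq L v.1) v.2).val

theorem iv_bounds {L d₁ n : ℕ} [NeZero n] (hL : 1 ≤ L) (hd : 1 ≤ d₁)
    (g : ℕ → Equiv.Perm (Fin n)) (x : J0 L d₁ n) :
    0 ≤ (iv g x).1 ∧ (iv g x).1 + hp g x ≤ (iv g x).2 ∧ (iv g x).2 < (n * (2 * L + d₁) : ℕ) := by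
  rcases x with ⟨k, s⟩ | ⟨q, s⟩
  · have h1 := lab_lt g s (ps k s) (lob_lt_hib (k := k) hL)
    have h2 : lab g (hib L k) (ps k s) < n * (2 * L + d₁) :=
      lab_bound g (ps k s) (hib_lt (by omega) k.2)
    simp only [iv, hp]
    split_ifs <;> refine ⟨by omega, by omega, by omega⟩
  · have h2 : lab g (pq L q) s < n * (2 * L + d₁) := lab_bound g s (pq_lt hd q.2)
    have h3 : lab g (pq L q) s ≥ (g (pq L q) s).val := by unfold lab; omega
    simp only [iv, hp]
    refine ⟨by omega, by omega, by omega⟩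

theorem sum_ps {n : ℕ} [NeZero n] (k : ℕ) (f : Fin n → ℤ) : ∑ s, f (ps k s) = ∑ s, f s := by
  unfold ps
  split_ifs
  · exact Equiv.sum_comp (Equiv.subRight (1 : Fin n)) f
  · rfl

theorem prod_ps {n : ℕ} [NeZero n] (k : ℕ) (f : Fin n → ℕ) : ∏ s, f (ps k s) = ∏ s, f s := by
  unfold ps
  split_ifs
  · exact Equiv.prod_comp (Equiv.subRight (1 : Fin n)) f
  · rfl

theorem prod_perm {n : ℕ} (π : Equiv.Perm (Fin n)) :
    ∏ s, ((π s).val + 1) = n.factorial := by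
  rw [Equiv.prod_comp π (fun s => s.val + 1), Fin.prod_univ_eq_prod_range (fun i => i + 1) n,
    Finset.prod_range_add_one_eq_factorial]

theorem prod_hp {L d₁ n : ℕ} [NeZero n] (g : ℕ → Equiv.Perm (Fin n)) :
    ∏ x : J0 L d₁ n, (hp g x + 1) = n.factorial ^ (2 * L + d₁ + d₁) := by
  rw [Fintype.prod_sum_type, Fintype.prod_prod_type, Fintype.prod_prod_type]
  have h1 : ∀ k : Fin (2 * L + d₁), ∏ s : Fin n, (hp g (Sum.inl (k, s) : J0 L d₁ n) + 1)
      = n.factorial := by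
    intro k
    simp only [hp]
    rw [prod_ps k.val (fun s => (g (hib L k) s).val + 1), prod_perm]
  have h2 : ∀ k : Fin d₁, ∏ s : Fin n, (hp g (Sum.inr (k, s) : J0 L d₁ n) + 1)
      = n.factorial := by
    intro k
    simp only [hp]
    rw [prod_perm]
  simp only [h1, h2, Finset.prod_const, Finset.card_univ, Fintype.card_fin]
  rw [← pow_add]

theorem block_sum {L d₁ : ℕ} (hL : 1 ≤ L) (hd : 1 ≤ d₁) (H : ℕ → ℤ) :
    ∑ k ∈ Finset.range (2 * L + d₁), (H (lob L k) - H (hib L k))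
      - ∑ q ∈ Finset.range d₁, H (pq L q)
      = ∑ k ∈ Finset.range (2 * L + d₁), (if k < L then H k else - H k) := by
  obtain ⟨e, rfl⟩ : ∃ e, d₁ = e + 1 := ⟨d₁ - 1, by omega⟩
  have hK : 2 * L + (e + 1) = L + (1 + (L + e)) := by omega
  rw [hK]
  simp only [Finset.sum_range_add, Finset.sum_range_succ' _ e, Finset.sum_range_one]
  have a1 : ∑ x ∈ Finset.range L, (H (lob L x) - H (hib L x))
      = ∑ x ∈ Finset.range L, (H x - H L) := by
    refine Finset.sum_congr rfl fun x hx => ?_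
    have := Finset.mem_range.1 hx
    simp [lob, hib, this]
  have a2 : ∑ x ∈ Finset.range L, (H (lob L (L + (1 + x))) - H (hib L (L + (1 + x))))
      = ∑ x ∈ Finset.range L, (H L - H (L + (1 + x))) := by
    refine Finset.sum_congr rfl fun x hx => ?_
    have := Finset.mem_range.1 hx
    have e1 : lob L (L + (1 + x)) = L := by unfold lob; split_ifs <;> omega
    have e2 : hib L (L + (1 + x)) = L + (1 + x) := by unfold hib; split_ifs <;> omega
    rw [e1, e2]
  have a3 : ∑ x ∈ Finset.range e, (H (lob L (L + (1 + (L + x)))) - H (hib L (L + (1 + (L + x)))))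
      = ∑ x ∈ Finset.range e, (H (2 * L + x) - H (L + (1 + (L + x)))) := by
    refine Finset.sum_congr rfl fun x hx => ?_
    have e1 : lob L (L + (1 + (L + x))) = 2 * L + x := by unfold lob; split_ifs <;> omega
    have e2 : hib L (L + (1 + (L + x))) = L + (1 + (L + x)) := by unfold hib; split_ifs <;> omega
    rw [e1, e2]
  have a4 : ∑ x ∈ Finset.range e, H (pq L (x + 1)) = ∑ x ∈ Finset.range e, H (2 * L + x) := by
    refine Finset.sum_congr rfl fun x hx => ?_
    have e1 : pq L (x + 1) = 2 * L + x := by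
      unfold pq; rw [if_neg (by omega)]; omega
    rw [e1]
  have b1 : ∑ x ∈ Finset.range L, (if x < L then H x else - H x)
      = ∑ x ∈ Finset.range L, H x := by
    refine Finset.sum_congr rfl fun x hx => ?_
    simp [Finset.mem_range.1 hx]
  have e1 : lob L (L + 0) = 0 := by unfold lob; split_ifs <;> omega
  have e2 : hib L (L + 0) = L := by unfold hib; split_ifs <;> omega
  have e3 : pq L 0 = 0 := rfl
  rw [a1, a2, a3, a4, b1, e1, e2, e3]
  have c : ∀ y, (if L + y < L then H (L + y) else - H (L + y)) = - H (L + y) := by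
    intro y; rw [if_neg (by omega)]
  simp only [c, Finset.sum_sub_distrib, Finset.sum_neg_distrib]
  simp only [add_zero]
  ring

theorem sign_sum (N Q i : ℕ) :
    ∑ x ∈ Finset.range N, (if x < Q then (if x < i then (1:ℤ) else 0)
        else - (if x < i then (1:ℤ) else 0))
      = if min N i ≤ Q then ((min N i : ℕ) : ℤ) else 2 * Q - (min N i : ℕ) := by
  induction N with
  | zero => simp
  | succ N ih =>
    rw [Finset.sum_range_succ, ih]
    split_ifs <;> omega

theorem coverage {L d₁ n : ℕ} [NeZero n] [NeZero d₁] (hL : 1 ≤ L)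
    (g : ℕ → Equiv.Perm (Fin n)) (i : ℕ) (hi : i ≤ n * (2 * L + d₁)) :
    (∑ j : {x : J0 L d₁ n // x ≠ Sum.inr (0, 0)},
      if (iv g j.1).1 ≤ i ∧ (i:ℤ) ≤ (iv g j.1).2 then (1:ℤ) else 0)
      = min ((n : ℤ) * d₁ + i) ((n * (2 * L + d₁) : ℕ) - i) := by
  have hd : 1 ≤ d₁ := Nat.one_le_iff_ne_zero.2 (NeZero.ne d₁)
  set h : ℕ → Fin n → ℤ := fun k s => if lab g k s < i then 1 else 0 with hh
  have hn0 := Fintype.sum_eq_add_sum_subtype_ne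
    (fun x : J0 L d₁ n => if (iv g x).1 ≤ i ∧ (i:ℤ) ≤ (iv g x).2 then (1:ℤ) else 0)
    (Sum.inr (0, 0))
  have hind : ∀ x : J0 L d₁ n, (if (iv g x).1 ≤ i ∧ (i:ℤ) ≤ (iv g x).2 then (1:ℤ) else 0)
      = (if (iv g x).1 ≤ i then 1 else 0) - (if (iv g x).2 < i then 1 else 0) := by
    intro x
    have := iv_bounds hL hd g x
    split_ifs <;> omega
  have hl : ∀ v : Fin (2 * L + d₁) × Fin n,
      (if (iv g (Sum.inl v : J0 L d₁ n)).1 ≤ i ∧ (i:ℤ) ≤ (iv g (Sum.inl v : J0 L d₁ n)).2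
        then (1:ℤ) else 0)
      = (h (lob L v.1) v.2 - h (hib L v.1) (ps v.1 v.2))
        + (if v = (0, 0) then 1 - h 0 0 else 0) := by
    rintro ⟨k, s⟩
    rw [hind]
    have e0 : ((k, s) = ((0, 0) : Fin (2 * L + d₁) × Fin n)) ↔ (k.val = 0 ∧ s = 0) := by
      rw [Prod.mk.injEq, Fin.ext_iff]; simp
    simp only [iv, e0, hh]
    by_cases hr : k.val = 0 ∧ s = 0
    · obtain ⟨h1, h2⟩ := hr
      have h3 : lob L 0 = 0 := by unfold lob; split_ifs <;> omega
      simp only [h1, h2, h3, and_self, if_true]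
      split_ifs <;> omega
    · simp only [hr, if_false]
      split_ifs <;> omega
  have hr : ∀ v : Fin d₁ × Fin n,
      (if (iv g (Sum.inr v : J0 L d₁ n)).1 ≤ i ∧ (i:ℤ) ≤ (iv g (Sum.inr v : J0 L d₁ n)).2
        then (1:ℤ) else 0) = 1 - h (pq L v.1) v.2 := by
    rintro ⟨q, s⟩
    rw [hind]
    simp only [iv, hh]
    split_ifs <;> omega
  rw [Fintype.sum_sum_type] at hn0
  simp only [hl, hr] at hn0
  rw [Finset.sum_add_distrib, Finset.sum_ite_eq' Finset.univ, if_pos (Finset.mem_univ _),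
    Finset.sum_sub_distrib, Finset.sum_sub_distrib] at hn0
  simp only [Fintype.sum_prod_type, sum_ps] at hn0
  set H : ℕ → ℤ := fun k => ∑ s, h k s with hH
  have r1 := Fin.sum_univ_eq_sum_range (fun k => ∑ s, h (lob L k) s) (2 * L + d₁)
  have r2 := Fin.sum_univ_eq_sum_range (fun k => ∑ s, h (hib L k) s) (2 * L + d₁)
  have r3 := Fin.sum_univ_eq_sum_range (fun k => ∑ s, h (pq L k) s) d₁
  have bs := block_sum hL hd H
  rw [Finset.sum_sub_distrib] at bs
  have e3 : pq L ((0 : Fin d₁) : ℕ) = 0 := rfl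
  have ls : ∑ k ∈ Finset.range (2 * L + d₁), (if k < L then H k else - H k)
      = ∑ x ∈ Finset.range (n * (2 * L + d₁)), (if x < n * L then (if x < i then (1:ℤ) else 0)
        else - (if x < i then (1:ℤ) else 0)) := by
    rw [← Fin.sum_univ_eq_sum_range (fun k => if k < L then H k else - H k),
      ← Fin.sum_univ_eq_sum_range (fun x => if x < n * L then (if x < i then (1:ℤ) else 0)
        else - (if x < i then (1:ℤ) else 0)),
      ← Equiv.sum_comp (labEquiv (2 * L + d₁) g), Fintype.sum_prod_type]
    refine Finset.sum_congr rfl fun k _ => ?_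
    simp only [labEquiv_val]
    have hk : ∀ s, (lab g k s < n * L ↔ k.val < L) := by
      intro s
      constructor
      · intro hlt
        by_contra hc
        have : n * L ≤ n * k.val := Nat.mul_le_mul_left _ (by omega)
        unfold lab at hlt
        omega
      · intro hlt
        exact lab_bound g s hlt
    simp only [hk, hH, hh]
    split_ifs
    · rfl
    · rw [Finset.sum_neg_distrib]; rfl
  rw [ls, sign_sum] at bs
  simp only [hH] at bs
  rw [r1, r2, r3, e3] at hn0
  simp only [Finset.sum_const, Finset.card_univ, Fintype.card_fin, nsmul_eq_mul,
    mul_one] at hn0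
  have hm : n * (2 * L + d₁) = 2 * (n * L) + n * d₁ := by ring
  have hc : (d₁:ℤ) * n = ((n * d₁ : ℕ) : ℤ) := by push_cast; ring
  have hc2 : (n:ℤ) * d₁ = ((n * d₁ : ℕ) : ℤ) := by push_cast; ring
  rw [min_eq_right hi] at bs
  rw [hm] at hi ⊢
  rw [hc] at hn0
  rw [hc2]
  generalize n * L = A at *
  generalize n * d₁ = D at *
  split_ifs at bs
  · rw [min_eq_left (by omega)]; omega
  · rw [min_eq_right (by omega)]; omega

end S2
namespace S2

/-- Parent of a vertex. -/
def vpar {L d₁ n : ℕ} [NeZero n] [NeZero d₁] (v : Fin (2 * L + d₁) × Fin n) :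
    Fin (2 * L + d₁) × Fin n :=
  (⟨pb L v.1, pb_lt (by have := NeZero.pos d₁; omega) v.1.2⟩, ps v.1 v.2)

/-- Parent of an interval. -/
def ipar {L d₁ n : ℕ} [NeZero n] [NeZero d₁] : J0 L d₁ n → Fin (2 * L + d₁) × Fin n
  | Sum.inl v => vpar v
  | Sum.inr v => (⟨pq L v.1, pq_lt (NeZero.pos d₁) v.1.2⟩, v.2)

/-- Rank function of the tree. -/
def rkV {L d₁ n : ℕ} (v : Fin (2 * L + d₁) × Fin n) : ℕ :=
  if v.1.val = 0 then 4 * v.2.val else if v.1.val = L then 4 * v.2.val + 2 else 4 * n + 2 * v.1.val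

theorem root_iff {L d₁ n : ℕ} [NeZero n] [NeZero d₁] (v : Fin (2 * L + d₁) × Fin n) :
    v = (0, 0) ↔ v.1.val = 0 ∧ v.2 = 0 := by
  obtain ⟨k, s⟩ := v
  rw [Prod.mk.injEq, Fin.ext_iff]; simp

theorem rk_par {L d₁ n : ℕ} [NeZero n] [NeZero d₁] (hL : 1 ≤ L) (v : Fin (2 * L + d₁) × Fin n)
    (hv : v ≠ (0, 0)) : rkV (vpar v) + 2 ≤ rkV v := by
  rw [Ne, root_iff] at hv
  obtain ⟨k, s⟩ := v
  show (if pb L k.val = 0 then 4 * (ps k.val s).val else if pb L k.val = L then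
      4 * (ps k.val s).val + 2 else 4 * n + 2 * pb L k.val) + 2 ≤
    (if k.val = 0 then 4 * s.val else if k.val = L then 4 * s.val + 2 else 4 * n + 2 * k.val)
  have hs := s.2
  have hk := k.2
  by_cases h0 : k.val = 0
  · have hs0 : s ≠ 0 := fun h => hv ⟨h0, h⟩
    have e1 : pb L k.val = L := by unfold pb; rw [if_pos (by omega)]
    have e2 : (ps k.val s).val = s.val - 1 := by
      unfold ps; rw [if_pos h0, Fin.val_sub_one_of_ne_zero hs0]
    have : s.val ≠ 0 := fun h => hs0 (Fin.ext (by simpa using h))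
    rw [e1, e2, if_neg (by omega), if_pos rfl, if_pos h0]
    omega
  · have e2 : ps k.val s = s := by unfold ps; rw [if_neg h0]
    rw [e2]
    unfold pb lob
    split_ifs <;> omega

/-- Label of a vertex. -/
def vl {L d₁ n : ℕ} (g : ℕ → Equiv.Perm (Fin n)) (v : Fin (2 * L + d₁) × Fin n) : ℕ :=
  lab g v.1 v.2

theorem vl_inj {L d₁ n : ℕ} (g : ℕ → Equiv.Perm (Fin n)) {v w : Fin (2 * L + d₁) × Fin n}
    (h : vl g v = vl g w) : v = w := by
  have := lab_inj g h
  exact Prod.ext (Fin.ext this.1) this.2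

theorem iv_edge {L d₁ n : ℕ} [NeZero n] [NeZero d₁] (hL : 1 ≤ L)
    (g : ℕ → Equiv.Perm (Fin n)) (v : Fin (2 * L + d₁) × Fin n) (hv : v ≠ (0, 0)) :
    ((iv g (Sum.inl v : J0 L d₁ n)).1 = vl g v + 1 ∧
      (iv g (Sum.inl v : J0 L d₁ n)).2 = vl g (vpar v)) ∨
    ((iv g (Sum.inl v : J0 L d₁ n)).1 = vl g (vpar v) + 1 ∧
      (iv g (Sum.inl v : J0 L d₁ n)).2 = vl g v) := by
  rw [Ne, root_iff] at hv
  obtain ⟨k, s⟩ := v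
  simp only [iv, vl, vpar, if_neg hv]
  by_cases h : k.val < L
  · left
    simp [lob, hib, pb, h]
  · right
    have e2 : ps k.val s = s := by unfold ps; rw [if_neg (by omega)]
    simp [hib, pb, h, e2]

theorem iv_root {L d₁ n : ℕ} [NeZero n] [NeZero d₁] (hL : 1 ≤ L)
    (g : ℕ → Equiv.Perm (Fin n)) :
    iv g (Sum.inl (0, 0) : J0 L d₁ n) = (0, (vl g (vpar (0, 0) : Fin (2 * L + d₁) × Fin n) : ℤ)) := by
  have : 0 < L := hL
  simp [iv, vl, vpar, hib, pb, this]

theorem incid {L d₁ n : ℕ} [NeZero n] [NeZero d₁] (hL : 1 ≤ L)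
    (g : ℕ → Equiv.Perm (Fin n)) (x : J0 L d₁ n) (v : Fin (2 * L + d₁) × Fin n) :
    ((iv g x).2 = (vl g v : ℤ) ∨ (iv g x).1 = (vl g v : ℤ) + 1) ↔
      (x = Sum.inl v ∧ v ≠ (0, 0)) ∨ v = ipar x := by
  rcases x with w | w
  · simp only [ipar, Sum.inl.injEq]
    by_cases hw : w = (0, 0)
    · subst hw
      rw [iv_root hL g]
      simp only [Nat.cast_inj]
      constructor
      · rintro (h | h)
        · exact Or.inr (vl_inj g h).symm
        · omega
      · rintro (⟨h1, h2⟩ | h)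
        · exact absurd h1.symm h2
        · left; rw [h]
    · constructor
      · intro h
        have : vl g v = vl g w ∨ vl g v = vl g (vpar w) := by
          rcases iv_edge hL g w hw with h' | h' <;> omega
        rcases this with h | h
        · left; have := vl_inj g h; subst this; exact ⟨rfl, hw⟩
        · right; exact vl_inj g h
      · rintro (⟨h1, h2⟩ | h)
        · subst h1
          rcases iv_edge hL g w hw with h' | h' <;> omega
        · subst h
          rcases iv_edge hL g w hw with h' | h' <;> omega
  · simp only [ipar, reduceCtorEq, false_and, false_or]
    have : iv g (Sum.inr w : J0 L d₁ n) = (0, (vl g (ipar (Sum.inr w : J0 L d₁ n)) : ℤ)) := rfl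
    rw [this]
    simp only [Nat.cast_inj]
    constructor
    · rintro (h | h)
      · exact (vl_inj g h).symm
      · omega
    · rintro h
      left; rw [h]; rfl

/-- Index type of intervals. -/
abbrev J (L d₁ n : ℕ) [NeZero n] [NeZero d₁] := {x : J0 L d₁ n // x ≠ Sum.inr (0, 0)}

theorem card_J (L d₁ n : ℕ) [NeZero n] [NeZero d₁] :
    Fintype.card (J L d₁ n) = (2 * L + d₁ + d₁) * n - 1 := by
  have h3 := Fintype.card_subtype_compl (fun y : J0 L d₁ n => y = Sum.inr (0, 0))
  rw [Fintype.card_subtype_eq] at h3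
  have h4 : Fintype.card (J0 L d₁ n) = (2 * L + d₁ + d₁) * n := by
    simp [J0]; ring
  rw [← h4, ← h3]

theorem adj_iff (m : ℕ) {t : ℕ} (f : Fin t → ℤ × ℤ) (j : Fin t) (i : Fin m) :
    (systemGraph m f).Adj (Sum.inl j) (Sum.inr i) ↔ ((f j).2 = (i : ℤ) ∨ (f j).1 = (i : ℤ) + 1) := by
  simp [systemGraph, SimpleGraph.fromRel_adj]

theorem adj_ll (m : ℕ) {t : ℕ} (f : Fin t → ℤ × ℤ) (j i : Fin t) :
    ¬ (systemGraph m f).Adj (Sum.inl j) (Sum.inl i) := by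
  simp [systemGraph, SimpleGraph.fromRel_adj]

theorem adj_rr (m : ℕ) {t : ℕ} (f : Fin t → ℤ × ℤ) (j i : Fin m) :
    ¬ (systemGraph m f).Adj (Sum.inr j) (Sum.inr i) := by
  simp [systemGraph, SimpleGraph.fromRel_adj]

theorem tree {L d₁ n : ℕ} [NeZero n] [NeZero d₁] (hL : 1 ≤ L)
    (g : ℕ → Equiv.Perm (Fin n)) {t : ℕ} (e : J L d₁ n ≃ Fin t) :
    (systemGraph (n * (2 * L + d₁)) (fun i => iv g (e.symm i).1)).IsTree := by
  have key : ∀ (j : J L d₁ n) (v : Fin (2 * L + d₁) × Fin n),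
      (systemGraph (n * (2 * L + d₁)) (fun i => iv g (e.symm i).1)).Adj (Sum.inl (e j))
        (Sum.inr (labEquiv _ g v)) ↔ (j.1 = Sum.inl v ∧ v ≠ (0, 0)) ∨ v = ipar j.1 := by
    intro j v
    rw [adj_iff, ← incid hL g, Equiv.symm_apply_apply]
    rfl
  refine isTree_of_parent _ (Equiv.sumCongr e (labEquiv (2 * L + d₁) g)) (Sum.inr (0, 0))
    (Sum.elim (fun j => Sum.inr (ipar j.1)) (fun v => Sum.inl ⟨Sum.inl v, by simp⟩))
    (Sum.elim (fun j => rkV (ipar j.1) + 1) rkV) ?_ ?_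
  · rintro (j | v) hy
    · simp only [Equiv.sumCongr_apply, Sum.map_inl, Sum.map_inr, Sum.elim_inl, Sum.elim_inr, key]
      exact ⟨by simp, by omega⟩
    · have hv : v ≠ (0, 0) := fun h => hy (by rw [h])
      have := rk_par hL v hv
      simp only [Equiv.sumCongr_apply, Sum.map_inl, Sum.map_inr, Sum.elim_inl, Sum.elim_inr]
      rw [SimpleGraph.adj_comm, key]
      refine ⟨Or.inl ⟨rfl, hv⟩, ?_⟩
      simp only [ipar]
      omega
  · rintro (j | v) (j' | v') h
    · exact absurd h (adj_ll _ _ _ _)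
    · simp only [Equiv.sumCongr_apply, Sum.map_inl, Sum.map_inr, key] at h
      rcases h with ⟨h1, h2⟩ | h
      · right
        refine ⟨by simpa using h2, ?_⟩
        simp only [Sum.elim_inr, Sum.inl.injEq]
        exact Subtype.ext h1
      · left; exact ⟨by simp, by simp [h]⟩
    · simp only [Equiv.sumCongr_apply, Sum.map_inl, Sum.map_inr] at h
      rw [SimpleGraph.adj_comm, key] at h
      rcases h with ⟨h1, h2⟩ | h
      · left
        refine ⟨by simpa using h2, ?_⟩
        simp only [Sum.elim_inr, Sum.inl.injEq]
        exact Subtype.ext h1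
      · right; exact ⟨by simp, by simp [h]⟩
    · exact absurd h (adj_rr _ _ _ _)

theorem edge_eq {L d₁ n : ℕ} [NeZero n] [NeZero d₁] (hL : 1 ≤ L)
    (g g' : ℕ → Equiv.Perm (Fin n)) {v v' : Fin (2 * L + d₁) × Fin n} (hv : v ≠ (0, 0))
    (hv' : v' ≠ (0, 0))
    (h : iv g (Sum.inl v : J0 L d₁ n) = iv g' (Sum.inl v' : J0 L d₁ n)) :
    (vl g v = vl g' v' ∧ vl g (vpar v) = vl g' (vpar v')) ∨
    (vl g v = vl g' (vpar v') ∧ vl g (vpar v) = vl g' v') := by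
  have a := iv_edge hL g v hv
  have b := iv_edge hL g' v' hv'
  rw [h] at a
  omega

theorem iv_pos {L d₁ n : ℕ} [NeZero n] [NeZero d₁] (hL : 1 ≤ L)
    (g : ℕ → Equiv.Perm (Fin n)) (x : J0 L d₁ n) :
    (iv g x).1 = 0 ∨ ∃ v, v ≠ (0, 0) ∧ x = Sum.inl v ∧ (iv g x).1 ≠ 0 := by
  rcases x with v | v
  · by_cases hv : v = (0, 0)
    · subst hv
      left; rw [iv_root hL g]
    · right
      refine ⟨v, hv, rfl, ?_⟩
      rcases iv_edge hL g v hv with h | h <;> omega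
  · left; rfl

theorem iv_inj {L d₁ n : ℕ} [NeZero n] [NeZero d₁] (hL : 1 ≤ L)
    (g : ℕ → Equiv.Perm (Fin n)) (x y : J L d₁ n) (h : iv g x.1 = iv g y.1) : x = y := by
  obtain ⟨x, hx⟩ := x
  obtain ⟨y, hy⟩ := y
  rw [Subtype.mk.injEq]
  simp only at h
  rcases iv_pos hL g x with h1 | ⟨v, hv, rfl, h1⟩ <;>
    rcases iv_pos hL g y with h2 | ⟨w, hw, rfl, h2⟩
  · have h0 : ∀ z : J0 L d₁ n, (iv g z).1 = 0 → z = Sum.inl (0, 0) ∨ ∃ w, z = Sum.inr w := by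
      rintro (v | w) hz
      · left
        by_contra hc
        have hv : v ≠ (0, 0) := fun h => hc (by rw [h])
        rcases iv_edge hL g v hv with h | h <;> omega
      · exact Or.inr ⟨w, rfl⟩
    have hr : ∀ w, Sum.inr w ≠ (Sum.inr (0, 0) : J0 L d₁ n) →
        iv g (Sum.inl (0, 0) : J0 L d₁ n) ≠ iv g (Sum.inr w : J0 L d₁ n) := by
      rintro ⟨q, s⟩ - hc
      rw [iv_root hL g] at hc
      have hc2 : lab g (pb L ((0 : Fin (2 * L + d₁)) : ℕ)) (ps ((0 : Fin (2 * L + d₁)) : ℕ) 0)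
        = lab g (pq L q) s := by
        have := congrArg Prod.snd hc
        simp only [iv] at this
        exact_mod_cast this
      have := (lab_inj g hc2).1
      have e1 : pb L ((0 : Fin (2 * L + d₁)) : ℕ) = L := by
        simp only [Fin.val_zero]; unfold pb; rw [if_pos (by omega)]
      rw [e1] at this
      unfold pq at this
      split_ifs at this <;> omega
    rcases h0 x h1 with rfl | ⟨w, rfl⟩ <;> rcases h0 y h2 with rfl | ⟨w', rfl⟩
    · rfl
    · exact absurd h (hr _ hy)
    · exact absurd h.symm (hr _ hx)
    · obtain ⟨q, s⟩ := w
      obtain ⟨q', s'⟩ := w'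
      have hc2 : lab g (pq L q) s = lab g (pq L q') s' := by
        have := congrArg Prod.snd h
        simp only [iv] at this
        exact_mod_cast this
      obtain ⟨e1, e2⟩ := lab_inj g hc2
      have : q = q' := by
        unfold pq at e1
        apply Fin.ext
        split_ifs at e1 <;> omega
      rw [this, e2]
  · exact absurd (by rw [← h]; exact h1) h2
  · exact absurd (by rw [h]; exact h2) h1
  · rcases edge_eq hL g g hv hw h with ⟨e, -⟩ | ⟨e1, e2⟩
    · rw [vl_inj g e]
    · have e1 := vl_inj g e1
      have e2 := vl_inj g e2
      have r1 := rk_par hL v hv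
      have r2 := rk_par hL w hw
      rw [e2] at r1
      rw [← e1] at r2
      omega

theorem vl_block {L d₁ n : ℕ} (g g' : ℕ → Equiv.Perm (Fin n)) {v w : Fin (2 * L + d₁) × Fin n}
    (h : vl g v = vl g' w) : v.1 = w.1 := Fin.ext (lab_block g g' h)

theorem ps_inj {n : ℕ} [NeZero n] (k : ℕ) {s s' : Fin n} (h : ps k s = ps k s') : s = s' := by
  unfold ps at h
  split_ifs at h
  · exact sub_left_injective h
  · exact h

theorem determined {L d₁ n : ℕ} [NeZero n] [NeZero d₁] (hL : 1 ≤ L)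
    (g g' : ℕ → Equiv.Perm (Fin n)) (h0 : g 0 0 = g' 0 0)
    (h : ∀ x : J L d₁ n, ∃ y : J L d₁ n, iv g x.1 = iv g' y.1) :
    ∀ N, ∀ v : Fin (2 * L + d₁) × Fin n, rkV v = N → vl g v = vl g' v := by
  intro N
  induction N using Nat.strong_induction_on with
  | _ N ih =>
    intro v hvN
    by_cases hv : v = (0, 0)
    · subst hv
      simp [vl, lab, h0]
    have rv := rk_par hL v hv
    have hp := ih _ (by omega) (vpar v) rfl
    obtain ⟨⟨y, hy⟩, e⟩ := h ⟨Sum.inl v, by simp⟩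
    simp only at e
    have hne : (iv g (Sum.inl v : J0 L d₁ n)).1 ≠ 0 := by
      rcases iv_edge hL g v hv with h | h <;> omega
    rcases iv_pos hL g' y with h1 | ⟨w, hw, rfl, h1⟩
    · exact absurd (by rw [e]; exact h1) hne
    rcases edge_eq hL g g' hv hw e with ⟨e1, e2⟩ | ⟨e1, e2⟩
    · have hb := vl_block g g' e1
      rw [hp] at e2
      have e3 := vl_inj g' e2
      have : v = w := by
        refine Prod.ext hb ?_
        have := congrArg Prod.snd e3
        simp only [vpar, hb] at this
        exact ps_inj _ this
      rw [e1, this]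
    · rw [hp] at e2
      have e3 := vl_inj g' e2
      have rw' := rk_par hL w hw
      rw [← e3] at rw'
      have := ih _ (by omega) (vpar (vpar v)) rfl
      rw [← e3, ← this] at e1
      have e4 := vl_inj g e1
      rw [← e4] at rw'
      omega

end S2
namespace S2

/-- Extension of a finite family of permutations. -/
def ext {K n : ℕ} (g : Fin K → Equiv.Perm (Fin n)) (k : ℕ) : Equiv.Perm (Fin n) :=
  if h : k < K then g ⟨k, h⟩ else 1

/-- Labelled data for the construction. -/
abbrev Data (L d₁ n : ℕ) [NeZero n] [NeZero d₁] :=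
  Σ g : Fin (2 * L + d₁) → Equiv.Perm (Fin n), ∀ j : J L d₁ n, Fin (hp (ext g) j.1 + 1)

/-- The marked system of the data. -/
def mk {L d₁ n : ℕ} [NeZero n] [NeZero d₁] (D : Data L d₁ n) : Multiset ((ℤ × ℤ) × ℤ) :=
  Finset.univ.val.map (fun j : J L d₁ n =>
    (iv (ext D.1) j.1, (iv (ext D.1) j.1).1 + ((D.2 j).val : ℤ)))

theorem mk_fst {L d₁ n : ℕ} [NeZero n] [NeZero d₁] (D : Data L d₁ n) :
    (mk D).map Prod.fst = Finset.univ.val.map (fun j : J L d₁ n => iv (ext D.1) j.1) := by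
  simp [mk, Multiset.map_map]

theorem mk_mem {L d₁ n : ℕ} [NeZero n] [NeZero d₁] (hL : 1 ≤ L) (D : Data L d₁ n) :
    IsMarkedSystem (n * (2 * L + d₁))
      (fun i : ℤ => (min ((n : ℤ) * d₁ + i) ((n * (2 * L + d₁) : ℕ) - i)).toNat)
      ((2 * L + d₁ + d₁) * n - 1) (mk D) := by
  classical
  have hd : 1 ≤ d₁ := NeZero.pos d₁
  refine ⟨?_, ⟨?_, ?_⟩, ?_, ?_⟩
  · intro p hp
    obtain ⟨j, -, rfl⟩ := Multiset.mem_map.1 hp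
    have h1 := iv_bounds hL hd (ext D.1) j.1
    have h2 := (D.2 j).2
    simp only
    omega
  · intro I hI
    rw [mk_fst] at hI
    obtain ⟨j, -, rfl⟩ := Multiset.mem_map.1 hI
    have h1 := iv_bounds hL hd (ext D.1) j.1
    omega
  · intro i hi0 hi
    obtain ⟨i, rfl⟩ := Int.eq_ofNat_of_zero_le hi0
    have hc := coverage hL (ext D.1) i (by exact_mod_cast hi)
    rw [mk_fst, Multiset.filter_map, Multiset.card_map]
    simp only
    rw [← hc, Finset.sum_boole]
    simp only [Int.toNat_natCast, Finset.card, Finset.filter_val, Function.comp_def]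
  · refine ⟨Fintype.card (J L d₁ n), fun i => iv (ext D.1) ((Fintype.equivFin _).symm i).1, ?_,
      tree hL _ _⟩
    rw [mk_fst, ← Fin.univ_val_map,
      ← Multiset.map_univ_val_equiv (Fintype.equivFin (J L d₁ n)).symm, Multiset.map_map]
    rfl
  · rw [← card_J]
    simp [mk]

theorem mk_inj {L d₁ n : ℕ} [NeZero n] [NeZero d₁] (hL : 1 ≤ L) (D D' : Data L d₁ n)
    (h : mk D = mk D') (h0 : D.1 0 0 = D'.1 0 0) : D = D' := by
  have hd : 1 ≤ d₁ := NeZero.pos d₁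
  have hex : ∀ x : J L d₁ n, ∃ y : J L d₁ n, iv (ext D'.1) y.1 = iv (ext D.1) x.1 ∧
      (iv (ext D'.1) y.1).1 + ((D'.2 y).val : ℤ) = (iv (ext D.1) x.1).1 + ((D.2 x).val : ℤ) := by
    intro x
    have : (iv (ext D.1) x.1, (iv (ext D.1) x.1).1 + ((D.2 x).val : ℤ)) ∈ mk D' := by
      rw [← h]
      exact Multiset.mem_map.2 ⟨x, Finset.mem_univ_val x, rfl⟩
    obtain ⟨y, -, hy⟩ := Multiset.mem_map.1 this
    rw [Prod.mk.injEq] at hy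
    exact ⟨y, hy.1, hy.2⟩
  have hg : D.1 = D'.1 := by
    have hdet := determined hL (ext D.1) (ext D'.1)
      (by
        have : (0 : ℕ) < 2 * L + d₁ := by omega
        simp only [ext, this, dif_pos]
        exact h0)
      (fun x => (hex x).imp fun y hy => hy.1.symm)
    funext k
    refine Equiv.ext fun s => ?_
    have := hdet _ (k, s) rfl
    have x1 : ext D.1 k.val = D.1 k := by simp [ext]
    have x2 : ext D'.1 k.val = D'.1 k := by simp [ext]
    simp only [vl, lab, x1, x2] at this
    exact Fin.ext (by omega)
  obtain ⟨g, y⟩ := D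
  obtain ⟨g', y'⟩ := D'
  simp only at hg
  subst hg
  congr 1
  funext j
  obtain ⟨j', e1, e2⟩ := hex j
  simp only at e1 e2
  have := iv_inj hL _ _ _ e1
  subst this
  exact Fin.ext (by omega)

theorem prod_J {L d₁ n : ℕ} [NeZero n] [NeZero d₁] (g : ℕ → Equiv.Perm (Fin n)) :
    n.factorial ^ (2 * L + d₁ + d₁) ≤ n * ∏ j : J L d₁ n, (hp g j.1 + 1) := by
  rw [← prod_hp (L := L) (d₁ := d₁) g,
    Fintype.prod_eq_mul_prod_subtype_ne (fun x : J0 L d₁ n => hp g x + 1) (Sum.inr (0, 0))]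
  refine Nat.mul_le_mul_right _ ?_
  exact (g _ _).2

theorem count {L d₁ n : ℕ} [NeZero n] [NeZero d₁] (hL : 1 ≤ L) :
    n.factorial ^ (4 * L + 3 * d₁) ≤ n * (n * Set.ncard {M : Multiset ((ℤ × ℤ) × ℤ) |
          IsMarkedSystem (n * (2 * L + d₁))
            (fun i : ℤ => (min ((n : ℤ) * d₁ + i) ((n * (2 * L + d₁) : ℕ) - i)).toNat)
            ((2 * L + d₁ + d₁) * n - 1) M}) := by
  set S := {M : Multiset ((ℤ × ℤ) × ℤ) |
          IsMarkedSystem (n * (2 * L + d₁))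
            (fun i : ℤ => (min ((n : ℤ) * d₁ + i) ((n * (2 * L + d₁) : ℕ) - i)).toNat)
            ((2 * L + d₁ + d₁) * n - 1) M} with hS
  have hfin : S.Finite := by
    refine markedFinite (n * (2 * L + d₁)) ((2 * L + d₁ + d₁) * n - 1) _ ?_
    intro M hM
    refine ⟨hM.2.2.2, fun p hp => ?_⟩
    have h1 := hM.1 p hp
    have h2 := hM.2.1.1 p.1 (Multiset.mem_map_of_mem _ hp)
    exact ⟨h2.1, h1.1, h1.2, h2.2.2⟩
  have : Finite S := hfin
  have h1 : Nat.card (Data L d₁ n) ≤ Nat.card (Fin n × S) := by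
    refine Nat.card_le_card_of_injective
      (fun D : Data L d₁ n => ((D.1 0 0, ⟨mk D, mk_mem hL D⟩) : Fin n × S)) ?_
    intro D D' h
    simp only [Prod.mk.injEq, Subtype.mk.injEq] at h
    exact mk_inj hL D D' h.2 h.1
  rw [Nat.card_prod, Nat.card_eq_fintype_card (α := Fin n), Fintype.card_fin,
    Nat.card_coe_set_eq] at h1
  have h2 : n.factorial ^ (4 * L + 3 * d₁) ≤ n * Nat.card (Data L d₁ n) := by
    rw [Nat.card_sigma, Finset.mul_sum]
    calc n.factorial ^ (4 * L + 3 * d₁)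
        = ∑ g : Fin (2 * L + d₁) → Equiv.Perm (Fin n), n.factorial ^ (2 * L + d₁ + d₁) := by
          rw [Finset.sum_const, Finset.card_univ, Fintype.card_fun, Fintype.card_perm,
            Fintype.card_fin, Fintype.card_fin, smul_eq_mul, ← pow_add]
          congr 1; ring
      _ ≤ _ := by
          refine Finset.sum_le_sum fun g _ => ?_
          rw [Nat.card_pi]
          simp only [Nat.card_eq_fintype_card, Fintype.card_fin]
          exact prod_J (ext g)
  exact h2.trans (Nat.mul_le_mul_left _ h1)

theorem log_fact (n : ℕ) (hn : 1 ≤ n) :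
    (n : ℝ) * Real.log n - n ≤ Real.log (n.factorial) := by
  induction n, hn using Nat.le_induction with
  | base => simp
  | succ n hn ih =>
    have hn0 : (0 : ℝ) < n := by exact_mod_cast hn
    rw [Nat.factorial_succ, Nat.cast_mul, Real.log_mul (by positivity) (by positivity)]
    have h1 : Real.log ((n + 1 : ℕ) : ℝ) - Real.log n ≤ 1 / n := by
      rw [← Real.log_div (by positivity) (by positivity)]
      refine (Real.log_le_sub_one_of_pos (by positivity)).trans (le_of_eq ?_)
      push_cast; field_simp; ring
    have h2 : (n : ℝ) * (Real.log ((n + 1 : ℕ) : ℝ) - Real.log n) ≤ 1 := by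
      calc _ ≤ (n : ℝ) * (1 / n) := by gcongr
        _ = 1 := by field_simp
    push_cast at *
    nlinarith

end S2

/-- Let `1 ≤ d₁ < d`.  There is a constant `C > 0` (depending only on `d`
and `d₁`) such that for every `n ≥ 1`, the number `S_n` of marked admissible proper systems
with parameters `m = n(2d - d₁)`, `σ(i) = min(n d₁ + i, m - i)`, consisting of exactly
`2nd - 1` intervals, satisfies `log S_n ≥ (4d - d₁) n log n - C n`. -/
theorem statement2 (d d₁ : ℕ) (hd₁ : 1 ≤ d₁) (hd : d₁ < d) :
    ∃ C : ℝ, 0 < C ∧ ∀ n : ℕ, 1 ≤ n →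
      (4 * (d : ℝ) - d₁) * n * Real.log n - C * n ≤
        Real.log (Set.ncard {M : Multiset ((ℤ × ℤ) × ℤ) |
          IsMarkedSystem (n * (2 * d - d₁))
            (fun i : ℤ => (min ((n : ℤ) * d₁ + i) ((n * (2 * d - d₁) : ℕ) - i)).toNat)
            (2 * n * d - 1) M}) := by
  obtain ⟨L, rfl⟩ : ∃ L, d = L + d₁ := ⟨d - d₁, by omega⟩
  have hL : 1 ≤ L := by omega
  have : NeZero d₁ := ⟨by omega⟩
  refine ⟨4 * L + 3 * d₁ + 2, by positivity, fun n hn => ?_⟩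
  have : NeZero n := ⟨by omega⟩
  have hc := S2.count (L := L) (d₁ := d₁) (n := n) hL
  have e1 : 2 * (L + d₁) - d₁ = 2 * L + d₁ := by omega
  have e2 : 2 * n * (L + d₁) - 1 = (2 * L + d₁ + d₁) * n - 1 := by congr 1; ring
  rw [e1, e2]
  generalize Set.ncard {M : Multiset ((ℤ × ℤ) × ℤ) | IsMarkedSystem (n * (2 * L + d₁))
    (fun i : ℤ => (min ((n : ℤ) * d₁ + i) ((n * (2 * L + d₁) : ℕ) - i)).toNat)
    ((2 * L + d₁ + d₁) * n - 1) M} = N at hc ⊢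
  have hn0 : (0 : ℝ) < n := by exact_mod_cast hn
  have hN : (0 : ℝ) < N := by
    have h1 : 0 < n * (n * N) := lt_of_lt_of_le (by positivity) hc
    have : 0 < N := Nat.pos_of_ne_zero (by rintro rfl; simp at h1)
    exact_mod_cast this
  have hc' : ((n.factorial : ℝ)) ^ (4 * L + 3 * d₁) ≤ n * (n * N) := by exact_mod_cast hc
  have hlog := Real.log_le_log (by positivity) hc'
  rw [Real.log_pow, Real.log_mul hn0.ne' (by positivity), Real.log_mul hn0.ne' hN.ne'] at hlog
  have hf := S2.log_fact n hn
  have hf' := mul_le_mul_of_nonneg_left hf (by positivity : (0 : ℝ) ≤ ((4 * L + 3 * d₁ : ℕ) : ℝ))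
  have hl := Real.log_le_sub_one_of_pos hn0
  push_cast at *
  linarith
end

section
/- Let d, d₁, d₂ be integers with 1 ≤ d₂ ≤ d₁ < d. There exists a constant C > 0 (depending only on d, d₁, d₂) such that for every integer n ≥ 1, the number S_n of marked admissible proper systems with parameters m = n(2d − d₁ − d₂) and σ(i) = min(n d₁ + i, m + n d₂ − i), consisting of exactly 2nd − 1 intervals, satisfies log S_n ≥ (4d − d₁ − d₂) n log n − C n. -/
open Finset in
lemma aux_filter_card {ι : Type*} (s : Finset ι) (F : ι → ℤ × ℤ) (P : ℤ × ℤ → Prop)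
    [DecidablePred P] :
    ((s.val.map F).filter P).card = ∑ i ∈ s, if P (F i) then 1 else 0 := by
  rw [Multiset.filter_map, Multiset.card_map, ← Finset.card_filter]
  rfl

lemma aux_adj (m : ℕ) {t : ℕ} (f : Fin t → ℤ × ℤ) (j : Fin t) (i : Fin m) :
    (systemGraph m f).Adj (Sum.inl j) (Sum.inr i) ↔
      ((f j).2 = (i : ℤ) ∨ (f j).1 = (i : ℤ) + 1) := by
  simp [systemGraph, SimpleGraph.fromRel_adj]

open Finset in
lemma aux_edge_card (m t : ℕ) (hm : 0 < m) (f : Fin t → ℤ × ℤ) :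
    Nat.card (systemGraph m f).edgeSet ≤
      (univ.filter fun j => (f j).2 < m).card + (univ.filter fun j => 0 < (f j).1).card := by
  classical
  let idx : ℤ → Fin m := fun z => ⟨z.toNat % m, Nat.mod_lt _ hm⟩
  let E : Finset (Sym2 (Fin t ⊕ Fin m)) :=
    ((univ.filter fun j => (f j).2 < m).image fun j => s(Sum.inl j, Sum.inr (idx (f j).2))) ∪
    ((univ.filter fun j => 0 < (f j).1).image fun j => s(Sum.inl j, Sum.inr (idx ((f j).1 - 1))))
  have key : ∀ (j : Fin t) (i : Fin m), (systemGraph m f).Adj (Sum.inl j) (Sum.inr i) →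
      s(Sum.inl j, Sum.inr i) ∈ E := by
    intro j i h
    rw [aux_adj] at h
    have hi := i.2
    rcases h with h | h
    · refine mem_union_left _ (mem_image.2 ⟨j, ?_, ?_⟩)
      · simp [h]
      · have : idx (f j).2 = i := by
          apply Fin.ext; simp [idx, h, Nat.mod_eq_of_lt hi]
        rw [this]
    · refine mem_union_right _ (mem_image.2 ⟨j, ?_, ?_⟩)
      · simp [h]
        try omega
      · have : idx ((f j).1 - 1) = i := by
          apply Fin.ext; simp [idx, h, Nat.mod_eq_of_lt hi]
        rw [this]
  have hsub : (systemGraph m f).edgeSet ⊆ (E : Set _) := by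
    intro e he
    induction e using Sym2.ind with
    | _ u v =>
      rw [SimpleGraph.mem_edgeSet] at he
      rcases u with j | i <;> rcases v with j' | i'
      · simp [systemGraph] at he
      · exact key j i' he
      · rw [Sym2.eq_swap]; exact key j' i he.symm
      · simp [systemGraph] at he
  calc Nat.card (systemGraph m f).edgeSet ≤ Nat.card (E : Set (Sym2 (Fin t ⊕ Fin m))) :=
        Nat.card_mono (Finset.finite_toSet E) hsub
    _ = E.card := by simp
    _ ≤ _ := (card_union_le _ _).trans (Nat.add_le_add card_image_le card_image_le)

open Finset in
lemma admissible_of (m t A B : ℕ) (hm : 0 < m) (S : Multiset (ℤ × ℤ)) (hc : S.card = t)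
    (hb : ∀ I ∈ S, 0 ≤ I.1 ∧ I.1 ≤ I.2 ∧ I.2 ≤ m)
    (hA : (S.filter fun I : ℤ × ℤ => I.1 ≤ 0 ∧ 0 ≤ I.2).card = A)
    (hB : (S.filter fun I : ℤ × ℤ => I.1 ≤ (m : ℤ) ∧ (m : ℤ) ≤ I.2).card = B)
    (hAB : t + 1 = A + B + m)
    (hne : ∀ I ∈ S, I.1 = 0 → I.2 < m)
    (r : ℕ) (hr : r < m)
    (hreach : ∀ i < m, Relation.EqvGen
      (fun a b : ℕ => a < m ∧ b < m ∧ (((a : ℤ) + 1, (b : ℤ)) : ℤ × ℤ) ∈ S) r i) :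
    IsAdmissible m S := by
  classical
  have hex : ∃ f : Fin t → ℤ × ℤ, univ.val.map f = S := by
    subst hc
    refine ⟨fun i => S.toList.get (i.cast (by simp)), ?_⟩
    rw [Fin.univ_val_map]
    conv_rhs => rw [← S.coe_toList]
    congr 1
    apply List.ext_get
    · simp
    · intro k h1 h2
      simp
  obtain ⟨f, hf⟩ := hex
  refine ⟨t, f, by rw [← hf, Fin.univ_val_map], ?_⟩
  have hmem : ∀ j, f j ∈ S := fun j => by rw [← hf]; simp
  have hreachG : ∀ a b : ℕ, Relation.EqvGen
      (fun a b : ℕ => a < m ∧ b < m ∧ (((a : ℤ) + 1, (b : ℤ)) : ℤ × ℤ) ∈ S) a b →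
      a = b ∨ ∃ (ha : a < m) (hb : b < m),
        (systemGraph m f).Reachable (Sum.inr ⟨a, ha⟩) (Sum.inr ⟨b, hb⟩) := by
    intro a b h
    induction h with
    | rel a b h =>
      obtain ⟨ha, hb, h⟩ := h
      right
      refine ⟨ha, hb, ?_⟩
      rw [← hf] at h
      obtain ⟨j, -, hj⟩ := Multiset.mem_map.1 h
      have h1 : (systemGraph m f).Adj (Sum.inl j) (Sum.inr ⟨a, ha⟩) := by
        rw [aux_adj]; right; rw [hj]
      have h2 : (systemGraph m f).Adj (Sum.inl j) (Sum.inr ⟨b, hb⟩) := by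
        rw [aux_adj]; left; rw [hj]
      exact h1.symm.reachable.trans h2.reachable
    | refl a => exact Or.inl rfl
    | symm a b _ ih =>
      rcases ih with h | ⟨ha, hb, h⟩
      · exact Or.inl h.symm
      · exact Or.inr ⟨hb, ha, h.symm⟩
    | trans a b c _ _ ih1 ih2 =>
      rcases ih1 with rfl | ⟨ha, hb, h⟩
      · exact ih2
      · rcases ih2 with rfl | ⟨hb', hc', h'⟩
        · exact Or.inr ⟨ha, hb, h⟩
        · exact Or.inr ⟨ha, hc', h.trans h'⟩
  have hW : ∀ i : Fin m, (systemGraph m f).Reachable (Sum.inr ⟨r, hr⟩) (Sum.inr i) := by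
    intro i
    rcases hreachG r i (hreach i i.2) with h | ⟨_, _, h⟩
    · have : (⟨r, hr⟩ : Fin m) = i := Fin.ext h
      rw [this]
    · exact h
  have hall : ∀ v, (systemGraph m f).Reachable (Sum.inr ⟨r, hr⟩) v := by
    rintro (j | i)
    · have h1 := hb _ (hmem j)
      by_cases h0 : (f j).1 = 0
      · have h2 := hne _ (hmem j) h0
        have : (systemGraph m f).Adj (Sum.inl j) (Sum.inr ⟨(f j).2.toNat, by omega⟩) := by
          rw [aux_adj]; left; simp; omega
        exact (hW _).trans this.symm.reachable
      · have : (systemGraph m f).Adj (Sum.inl j) (Sum.inr ⟨((f j).1 - 1).toNat, by omega⟩) := by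
          rw [aux_adj]; right; simp; omega
        exact (hW _).trans this.symm.reachable
    · exact hW i
  have hconn : (systemGraph m f).Connected := by
    have : Nonempty (Fin t ⊕ Fin m) := ⟨Sum.inr ⟨r, hr⟩⟩
    exact ⟨fun u v => (hall u).symm.trans (hall v)⟩
  rw [SimpleGraph.isTree_iff_connected_and_card]
  refine ⟨hconn, le_antisymm ?_ hconn.card_vert_le_card_edgeSet_add_one⟩
  have hE := aux_edge_card m t hm f
  have h1 : (univ.filter fun j => (f j).2 < m).card + B = t := by
    rw [← hB, ← hf, aux_filter_card, ← Finset.card_filter]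
    have : (univ.filter fun j => (f j).1 ≤ m ∧ (m : ℤ) ≤ (f j).2)
        = univ.filter fun j => ¬ (f j).2 < m := by
      apply filter_congr
      intro j _
      have := hb _ (hmem j)
      omega
    rw [this, Finset.card_filter_add_card_filter_not]
    simp
  have h2 : (univ.filter fun j => 0 < (f j).1).card + A = t := by
    rw [← hA, ← hf, aux_filter_card, ← Finset.card_filter]
    have : (univ.filter fun j => (f j).1 ≤ 0 ∧ (0 : ℤ) ≤ (f j).2)
        = univ.filter fun j => ¬ 0 < (f j).1 := by
      apply filter_congr
      intro j _
      have := hb _ (hmem j)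
      omega
    rw [this, Finset.card_filter_add_card_filter_not]
    simp
  simp only [Nat.card_eq_fintype_card, Fintype.card_sum, Fintype.card_fin] at *
  omega

/-- a marked interval with natural number data -/
def tri (a b k : ℕ) : (ℤ × ℤ) × ℤ := (((a : ℤ), (b : ℤ)), (k : ℤ))

lemma tri_inj {a b k a' b' k' : ℕ} : tri a b k = tri a' b' k' ↔ a = a' ∧ b = b' ∧ k = k' := by
  simp [tri, and_assoc]

/-- combinatorial data of our family of systems -/
@[ext]
structure Dat (n p q D d : ℕ) where
  c : Fin p → Equiv.Perm (Fin n)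
  e : Fin q → Equiv.Perm (Fin n)
  s : Equiv.Perm (Fin n)
  oA : Fin p × Fin n → ℕ
  oS : Fin n → ℕ
  oP : Fin n → ℕ
  oR : Fin q × Fin n → ℕ
  oa : Fin D × Fin n → ℕ
  ob : Fin d × Fin n → ℕ

/-- bounds on the mark offsets -/
structure Dat.Ok {n p q D d : ℕ} (K : ℕ) (X : Dat n p q D d) : Prop where
  hA : ∀ i, X.oA i < n - i.2
  hS : ∀ y, X.oS y < max (y : ℕ) 1
  hS0 : ∀ y : Fin n, (y : ℕ) = 0 → X.oS y = 0
  hP : ∀ u : Fin n, X.oP u < (u : ℕ) + 1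
  hR : ∀ i, X.oR i < (i.2 : ℕ) + 1
  ha : ∀ i, X.oa i < max (((i.2 : ℕ) + 1) / K) 1
  hb : ∀ i, X.ob i < max ((n - (i.2 : ℕ)) / K) 1

section sys
variable {n p q D d : ℕ} (K : ℕ) (X : Dat n p q D d)

def fA (i : Fin p × Fin n) : (ℤ × ℤ) × ℤ :=
  tri (i.1 * n + i.2 + 1) (p * n + X.c i.1 i.2) (i.1 * n + i.2 + 1 + X.oA i)
def fS (y : Fin n) : (ℤ × ℤ) × ℤ :=
  tri (X.s y + 1) (p * n + y) (p * n + 1 + X.oS y)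
def fP (u : Fin n) : (ℤ × ℤ) × ℤ :=
  tri 0 (if (X.s.symm u : ℕ) = 0 then p * n else u) (X.oP u)
def fR (i : Fin q × Fin n) : (ℤ × ℤ) × ℤ :=
  tri (p * n + X.e i.1 i.2 + 1) (p * n + n + (i.1 * n + i.2)) (p * n + n + i.1 * n + X.oR i)
def fa (i : Fin D × Fin n) : (ℤ × ℤ) × ℤ :=
  tri 0 (p * n + i.2) (p * n + i.1 * (((i.2 : ℕ) + 1) / K) + X.oa i)
def fb (i : Fin d × Fin n) : (ℤ × ℤ) × ℤ :=
  tri (p * n + i.2 + 1) (p * n + n + q * n)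
    (p * n + i.2 + 1 + i.1 * ((n - (i.2 : ℕ)) / K) + X.ob i)

open Finset in
def sysM : Multiset ((ℤ × ℤ) × ℤ) :=
  (univ : Finset (Fin p × Fin n)).val.map (fA X) +
  (univ.filter fun y : Fin n => (y : ℕ) ≠ 0).val.map (fS X) +
  (univ : Finset (Fin n)).val.map (fP X) +
  (univ : Finset (Fin q × Fin n)).val.map (fR X) +
  (univ : Finset (Fin D × Fin n)).val.map (fa K X) +
  (univ : Finset (Fin d × Fin n)).val.map (fb K X)

lemma mem_sysM (T : (ℤ × ℤ) × ℤ) : T ∈ sysM K X ↔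
    (∃ i, T = fA X i) ∨ (∃ y : Fin n, (y : ℕ) ≠ 0 ∧ T = fS X y) ∨ (∃ u, T = fP X u) ∨
    (∃ i, T = fR X i) ∨ (∃ i, T = fa K X i) ∨ (∃ i, T = fb K X i) := by
  simp only [sysM, Multiset.mem_add, Multiset.mem_map, Finset.mem_val, Finset.mem_univ, true_and,
    Finset.mem_filter, or_assoc, eq_comm]
  
end sys

lemma blk {l p x n : ℕ} (hl : l < p) (hx : x < n) : l * n + n ≤ p * n := by
  nlinarith

lemma blk_inj {l l' x x' n : ℕ} (hx : x < n) (hx' : x' < n) (h : l * n + x = l' * n + x') :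
    l = l' ∧ x = x' := by
  have h1 : l = l' := by
    rcases lt_trichotomy l l' with h2 | h2 | h2
    · have := blk h2 hx; omega
    · exact h2
    · have := blk h2 hx; omega
  subst h1
  exact ⟨rfl, by omega⟩

lemma copy_inj {c c' h o o' o'' : ℕ} (ho : o < max h 1) (ho' : o' < max h 1)
    (ho'' : o'' < max h 1)
    (e : c * h + o = c' * h + o') (e' : c = c' → o' = o'') : o = o'' := by
  rcases Nat.eq_zero_or_pos h with rfl | hp
  · simp at *; omega
  · have : max h 1 = h := by omega
    rw [this] at ho ho'
    have := blk_inj ho ho' e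
    rw [this.2, e' this.1]

lemma copy_lt {c D K N o : ℕ} (hc : c < D) (hK : D ≤ K) (hN : 0 < N) (ho : o < max (N / K) 1) :
    c * (N / K) + o < N := by
  rcases Nat.eq_zero_or_pos (N / K) with h | hp
  · rw [h] at ho ⊢; simp at *; omega
  · have : max (N / K) 1 = N / K := by omega
    rw [this] at ho
    have h1 := blk (lt_of_lt_of_le hc hK) ho
    have h2 : K * (N / K) ≤ N := Nat.mul_div_le N K
    omega

/-- coarse facts about marks and endpoints that separate the six kinds. -/
lemma sysM_inj {n p q D d K : ℕ} (hp : 0 < p) (hDK : D ≤ K) (hdK : d ≤ K) (hn : 0 < n)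
    (X X' : Dat n p q D d) (hX : X.Ok K) (hX' : X'.Ok K) (h : sysM K X = sysM K X') : X = X' := by
  have hpn : n ≤ p * n := by nlinarith
  have hmem : ∀ T, T ∈ sysM K X → T ∈ sysM K X' := fun T hT => h ▸ hT
  have hA : ∀ i, X.c i.1 i.2 = X'.c i.1 i.2 ∧ X.oA i = X'.oA i := by
    intro i
    have h1 := hmem _ ((mem_sysM K X _).2 (Or.inl ⟨i, rfl⟩))
    rw [mem_sysM] at h1
    have b0 := blk i.1.2 i.2.2
    have b1 := hX.hA i
    have b2 := i.2.2
    rcases h1 with ⟨j, hj⟩ | ⟨y, hy, hj⟩ | ⟨u, hj⟩ | ⟨j, hj⟩ | ⟨j, hj⟩ | ⟨j, hj⟩ <;>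
      simp only [fA, fS, fP, fR, fa, fb, tri_inj] at hj <;> obtain ⟨h1, h2, h3⟩ := hj
    · obtain ⟨e1, e2⟩ := blk_inj (l := i.1) (l' := j.1) i.2.2 j.2.2 (by omega)
      have : i = j := Prod.ext (Fin.ext e1) (Fin.ext e2)
      subst this
      exact ⟨Fin.ext (by omega), by omega⟩
    all_goals exfalso; omega
  have hS : ∀ y : Fin n, (y : ℕ) ≠ 0 → X.s y = X'.s y ∧ X.oS y = X'.oS y := by
    intro i hi
    have h1 := hmem _ ((mem_sysM K X _).2 (Or.inr (Or.inl ⟨i, hi, rfl⟩)))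
    rw [mem_sysM] at h1
    have b2 := i.2
    have b3 := (X.s i).2
    rcases h1 with ⟨j, hj⟩ | ⟨y, hy, hj⟩ | ⟨u, hj⟩ | ⟨j, hj⟩ | ⟨j, hj⟩ | ⟨j, hj⟩ <;>
      simp only [fA, fS, fP, fR, fa, fb, tri_inj] at hj <;> obtain ⟨h1, h2, h3⟩ := hj
    · have b0 := blk j.1.2 j.2.2
      have b1 := hX'.hA j
      exfalso; omega
    · have : i = y := Fin.ext (by omega)
      subst this
      exact ⟨Fin.ext (by omega), by omega⟩
    all_goals exfalso; omega
  have hs : X.s = X'.s := by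
    ext1 y
    by_cases hy : (y : ℕ) = 0
    · obtain ⟨z, hz⟩ := X'.s.surjective (X.s y)
      by_cases hzy : z = y
      · rw [← hz, hzy]
      · have hz0 : (z : ℕ) ≠ 0 := fun h0 => hzy (Fin.ext (by omega))
        rw [← (hS z hz0).1] at hz
        exact absurd (X.s.injective hz) hzy
    · exact (hS y hy).1
  have hP : ∀ u, X.oP u = X'.oP u := by
    intro i
    have h1 := hmem _ ((mem_sysM K X _).2 (Or.inr (Or.inr (Or.inl ⟨i, rfl⟩))))
    rw [mem_sysM] at h1
    have b1 := hX.hP i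
    have b2 := i.2
    rcases h1 with ⟨j, hj⟩ | ⟨y, hy, hj⟩ | ⟨u, hj⟩ | ⟨j, hj⟩ | ⟨j, hj⟩ | ⟨j, hj⟩ <;>
      simp only [fA, fS, fP, fR, fa, fb, tri_inj] at hj <;> obtain ⟨h1, h2, h3⟩ := hj
    · exfalso; omega
    · exfalso; omega
    · have : i = u := by
        rw [hs] at h2
        have b4 := u.2
        split_ifs at h2 with c1 c2
        · exact X'.s.symm.injective (Fin.ext (by omega))
        · omega
        · omega
        · exact Fin.ext h2
      subst this
      exact h3
    all_goals exfalso; omega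
  have hR : ∀ i, X.e i.1 i.2 = X'.e i.1 i.2 ∧ X.oR i = X'.oR i := by
    intro i
    have h1 := hmem _ ((mem_sysM K X _).2 (Or.inr (Or.inr (Or.inr (Or.inl ⟨i, rfl⟩)))))
    rw [mem_sysM] at h1
    have b0 := blk i.1.2 i.2.2
    have b1 := hX.hR i
    have b2 := i.2.2
    rcases h1 with ⟨j, hj⟩ | ⟨y, hy, hj⟩ | ⟨u, hj⟩ | ⟨j, hj⟩ | ⟨j, hj⟩ | ⟨j, hj⟩ <;>
      simp only [fA, fS, fP, fR, fa, fb, tri_inj] at hj <;> obtain ⟨h1, h2, h3⟩ := hj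
    · have b3 := blk j.1.2 j.2.2
      exfalso; omega
    · exfalso; omega
    · exfalso; omega
    · obtain ⟨e1, e2⟩ := blk_inj (l := i.1) (l' := j.1) i.2.2 j.2.2 (by omega)
      have : i = j := Prod.ext (Fin.ext e1) (Fin.ext e2)
      subst this
      exact ⟨Fin.ext (by omega), by omega⟩
    all_goals exfalso; omega
  have ha : ∀ i, X.oa i = X'.oa i := by
    intro i
    have h1 := hmem _ ((mem_sysM K X _).2 (Or.inr (Or.inr (Or.inr (Or.inr (Or.inl ⟨i, rfl⟩))))))
    rw [mem_sysM] at h1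
    have b1 := hX.ha i
    have b2 := i.2.2
    rcases h1 with ⟨j, hj⟩ | ⟨y, hy, hj⟩ | ⟨u, hj⟩ | ⟨j, hj⟩ | ⟨j, hj⟩ | ⟨j, hj⟩ <;>
      simp only [fA, fS, fP, fR, fa, fb, tri_inj] at hj <;> obtain ⟨h1, h2, h3⟩ := hj
    · exfalso; omega
    · exfalso; omega
    · have := hX'.hP u
      exfalso; omega
    · exfalso; omega
    · have e2 : i.2 = j.2 := Fin.ext (by omega)
      rw [← e2] at h3
      have b5 := hX'.ha j
      rw [← e2] at b5
      refine copy_inj b1 b5 (hX'.ha i) (c := i.1) (c' := j.1) (by omega) (fun e1 => ?_)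
      have : i = j := Prod.ext (Fin.ext e1) e2
      rw [this]
    · exfalso; omega
  have hb : ∀ i, X.ob i = X'.ob i := by
    intro i
    have h1 := hmem _ ((mem_sysM K X _).2 (Or.inr (Or.inr (Or.inr (Or.inr (Or.inr ⟨i, rfl⟩))))))
    rw [mem_sysM] at h1
    have b1 := hX.hb i
    have b2 := i.2.2
    rcases h1 with ⟨j, hj⟩ | ⟨y, hy, hj⟩ | ⟨u, hj⟩ | ⟨j, hj⟩ | ⟨j, hj⟩ | ⟨j, hj⟩ <;>
      simp only [fA, fS, fP, fR, fa, fb, tri_inj] at hj <;> obtain ⟨h1, h2, h3⟩ := hj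
    · have b3 := blk j.1.2 j.2.2
      exfalso; omega
    · exfalso; omega
    · exfalso; omega
    · have b3 := blk j.1.2 j.2.2
      exfalso; omega
    · exfalso; omega
    · have e2 : i.2 = j.2 := Fin.ext (by omega)
      rw [← e2] at h3
      have b5 := hX'.hb j
      rw [← e2] at b5
      refine copy_inj b1 b5 (hX'.hb i) (c := i.1) (c' := j.1) (by omega) (fun e1 => ?_)
      have : i = j := Prod.ext (Fin.ext e1) e2
      rw [this]
  apply Dat.ext
  · funext l; ext1 x; exact (hA (l, x)).1
  · funext l; ext1 x; exact (hR (l, x)).1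
  · exact hs
  · funext i; exact (hA i).2
  · funext y
    by_cases hy : (y : ℕ) = 0
    · rw [hX.hS0 y hy, hX'.hS0 y hy]
    · exact (hS y hy).2
  · funext u; exact hP u
  · funext i; exact (hR i).2
  · funext i; exact ha i
  · funext i; exact hb i

open Finset in
lemma card_sysM {n p q D d K : ℕ} (hn : 0 < n) (X : Dat n p q D d) :
    (sysM K X).card + 1 = p * n + n + n + q * n + D * n + d * n := by
  have : (univ.filter fun y : Fin n => (y : ℕ) ≠ 0).card + 1 = n := by
    have h : (univ.filter fun y : Fin n => (y : ℕ) ≠ 0) = univ.erase ⟨0, hn⟩ := by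
      ext y; simp [Fin.ext_iff]
    rw [h, card_erase_of_mem (mem_univ _)]
    simp; omega
  simp only [sysM, Multiset.card_add, Multiset.card_map, Finset.card_val, Finset.card_univ,
    Fintype.card_prod, Fintype.card_fin]
  omega

lemma bounds_sysM {n p q D d K : ℕ} (hp : 0 < p) (hDK : D ≤ K) (hdK : d ≤ K) (hn : 0 < n)
    (X : Dat n p q D d) (hX : X.Ok K) (T) (hT : T ∈ sysM K X) :
    ∃ a b k : ℕ, T = tri a b k ∧ a ≤ k ∧ k ≤ b ∧ b ≤ p * n + n + q * n ∧
      (a = 0 → b < p * n + n + q * n) := by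
  have hpn : n ≤ p * n := by nlinarith
  rw [mem_sysM] at hT
  rcases hT with ⟨j, hj⟩ | ⟨y, hy, hj⟩ | ⟨u, hj⟩ | ⟨j, hj⟩ | ⟨j, hj⟩ | ⟨j, hj⟩
  · refine ⟨_, _, _, hj, ?_⟩
    have := blk j.1.2 j.2.2
    have := hX.hA j
    have := (X.c j.1 j.2).2
    omega
  · refine ⟨_, _, _, hj, ?_⟩
    have := hX.hS y
    have := (X.s y).2
    omega
  · refine ⟨_, _, _, hj, ?_⟩
    have := hX.hP u
    have := u.2
    split_ifs <;> omega
  · refine ⟨_, _, _, hj, ?_⟩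
    have := blk j.1.2 j.2.2
    have := hX.hR j
    have := (X.e j.1 j.2).2
    omega
  · refine ⟨_, _, _, hj, ?_⟩
    have := copy_lt j.1.2 hDK (by omega) (hX.ha j)
    have := j.2.2
    omega
  · refine ⟨_, _, _, hj, ?_⟩
    have := j.2.2
    have := copy_lt j.1.2 hdK (by omega) (hX.hb j)
    omega

lemma sum_H (N : ℕ) (x w : ℕ) :
    ∑ v : Fin N, (if w + (v : ℕ) < x then (1 : ℤ) else 0) = ((min (x - w) N : ℕ) : ℤ) := by
  rw [Fin.sum_univ_eq_sum_range (fun v => if w + v < x then (1 : ℤ) else 0)]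
  induction N with
  | zero => simp
  | succ N ih =>
    rw [Finset.sum_range_succ, ih]
    split_ifs <;> omega

lemma sum_HH (p n : ℕ) (x w : ℕ) :
    ∑ i : Fin p × Fin n, (if w + ((i.1 : ℕ) * n + i.2) < x then (1 : ℤ) else 0)
      = ((min (x - w) (p * n) : ℕ) : ℤ) := by
  rw [← sum_H (p * n) x w, ← finProdFinEquiv.sum_comp]
  apply Finset.sum_congr rfl
  intro i _
  have : w + ((i.1 : ℕ) * n + i.2) = w + ((finProdFinEquiv i : Fin (p * n)) : ℕ) := by
    simp [finProdFinEquiv]; ring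
  rw [this]

open Finset in
lemma aux_filter_card' {ι : Type*} (s : Finset ι) (F : ι → (ℤ × ℤ) × ℤ) (x : ℤ) :
    (((((s.val.map F).map Prod.fst).filter fun I => I.1 ≤ x ∧ x ≤ I.2).card : ℕ) : ℤ) =
      ∑ i ∈ s, if (F i).1.1 ≤ x ∧ x ≤ (F i).1.2 then 1 else 0 := by
  rw [Multiset.map_map, aux_filter_card]
  simp

open Finset in
lemma cover_sysM {n p q D d K : ℕ} (hp : 0 < p) (hn : 0 < n) (hpar : D + p = d + q)
    (X : Dat n p q D d) (x : ℕ) (hx : x ≤ p * n + n + q * n) :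
    (((((sysM K X).map Prod.fst).filter fun I => I.1 ≤ (x : ℤ) ∧ (x : ℤ) ≤ I.2).card : ℕ) : ℤ) =
      min (n * (D + 1) + (x : ℤ)) (p * n + n + q * n + n * d - x) := by
  have hpn : n ≤ p * n := by nlinarith
  set Y : ℤ := ∑ y : Fin n, (if p * n + (y : ℕ) < x then (1 : ℤ) else 0) with hY
  have eA : ∑ i : Fin p × Fin n, (if (fA X i).1.1 ≤ (x : ℤ) ∧ (x : ℤ) ≤ (fA X i).1.2
      then (1 : ℤ) else 0) = ((min (x - 0) (p * n) : ℕ) : ℤ) - p * Y := by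
    rw [← sum_HH]
    have : (p : ℤ) * Y = ∑ i : Fin p × Fin n,
        (if p * n + (X.c i.1 i.2 : ℕ) < x then (1 : ℤ) else 0) := by
      rw [Fintype.sum_prod_type]
      simp only
      have : ∀ l : Fin p, ∑ y : Fin n, (if p * n + (X.c l y : ℕ) < x then (1 : ℤ) else 0) = Y :=
        fun l => Equiv.sum_comp (X.c l) (fun y : Fin n => if p * n + (y : ℕ) < x then (1 : ℤ) else 0)
      rw [Finset.sum_congr rfl (fun l _ => this l)]
      simp
    rw [this, ← sum_sub_distrib]
    apply sum_congr rfl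
    intro i _
    have := blk i.1.2 i.2.2
    have := i.2.2
    simp only [fA, tri]
    split_ifs <;> omega
  have eR : ∑ i : Fin q × Fin n, (if (fR X i).1.1 ≤ (x : ℤ) ∧ (x : ℤ) ≤ (fR X i).1.2
      then (1 : ℤ) else 0) = q * Y - ((min (x - (p * n + n)) (q * n) : ℕ) : ℤ) := by
    rw [← sum_HH]
    have : (q : ℤ) * Y = ∑ i : Fin q × Fin n,
        (if p * n + (X.e i.1 i.2 : ℕ) < x then (1 : ℤ) else 0) := by
      rw [Fintype.sum_prod_type]
      simp only
      have : ∀ l : Fin q, ∑ y : Fin n, (if p * n + (X.e l y : ℕ) < x then (1 : ℤ) else 0) = Y :=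
        fun l => Equiv.sum_comp (X.e l) (fun y : Fin n => if p * n + (y : ℕ) < x then (1 : ℤ) else 0)
      rw [Finset.sum_congr rfl (fun l _ => this l)]
      simp
    rw [this, ← sum_sub_distrib]
    apply sum_congr rfl
    intro i _
    have := i.2.2
    have := (X.e i.1 i.2).2
    simp only [fR, tri]
    split_ifs <;> omega
  have ea : ∑ i : Fin D × Fin n, (if (fa K X i).1.1 ≤ (x : ℤ) ∧ (x : ℤ) ≤ (fa K X i).1.2
      then (1 : ℤ) else 0) = D * (n - Y) := by
    rw [Fintype.sum_prod_type]
    have : ∀ l : Fin D, ∑ y : Fin n, (if (fa K X (l, y)).1.1 ≤ (x : ℤ) ∧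
        (x : ℤ) ≤ (fa K X (l, y)).1.2 then (1 : ℤ) else 0) = n - Y := by
      intro l
      have : (n : ℤ) = ∑ y : Fin n, (1 : ℤ) := by simp
      rw [this, hY, ← sum_sub_distrib]
      apply sum_congr rfl
      intro i _
      simp only [fa, tri]
      split_ifs <;> omega
    rw [Finset.sum_congr rfl (fun l _ => this l)]
    simp
    ring
  have eb : ∑ i : Fin d × Fin n, (if (fb K X i).1.1 ≤ (x : ℤ) ∧ (x : ℤ) ≤ (fb K X i).1.2
      then (1 : ℤ) else 0) = d * Y := by
    rw [Fintype.sum_prod_type]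
    have : ∀ l : Fin d, ∑ y : Fin n, (if (fb K X (l, y)).1.1 ≤ (x : ℤ) ∧
        (x : ℤ) ≤ (fb K X (l, y)).1.2 then (1 : ℤ) else 0) = Y := by
      intro l
      rw [hY]
      apply sum_congr rfl
      intro i _
      simp only [fb, tri]
      split_ifs <;> omega
    rw [Finset.sum_congr rfl (fun l _ => this l)]
    simp
  have eSP : (∑ y ∈ univ.filter (fun y : Fin n => (y : ℕ) ≠ 0),
      (if (fS X y).1.1 ≤ (x : ℤ) ∧ (x : ℤ) ≤ (fS X y).1.2 then (1 : ℤ) else 0)) +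
      ∑ u : Fin n, (if (fP X u).1.1 ≤ (x : ℤ) ∧ (x : ℤ) ≤ (fP X u).1.2 then (1 : ℤ) else 0)
      = n - Y := by
    rw [← Equiv.sum_comp X.s (fun u => if (fP X u).1.1 ≤ (x : ℤ) ∧ (x : ℤ) ≤ (fP X u).1.2
      then (1 : ℤ) else 0), sum_filter, ← sum_add_distrib]
    have : (n : ℤ) = ∑ y : Fin n, (1 : ℤ) := by simp
    rw [this, hY, ← sum_sub_distrib]
    apply sum_congr rfl
    intro y _
    have := (X.s y).2
    simp only [fS, fP, tri, Equiv.symm_apply_apply]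
    split_ifs <;> omega
  have hYv : Y = ((min (x - p * n) n : ℕ) : ℤ) := sum_H n x (p * n)
  have htot : (((((sysM K X).map Prod.fst).filter
      fun I => I.1 ≤ (x : ℤ) ∧ (x : ℤ) ≤ I.2).card : ℕ) : ℤ) =
      ((min (x - 0) (p * n) : ℕ) : ℤ) - p * Y + (n - Y) +
      (q * Y - ((min (x - (p * n + n)) (q * n) : ℕ) : ℤ)) + D * (n - Y) + d * Y := by
    rw [← eA, ← eR, ← ea, ← eb, ← eSP]
    simp only [sysM, Multiset.map_add, Multiset.filter_add, Multiset.card_add, Nat.cast_add,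
      aux_filter_card']
    ring
  rw [htot]
  have hpar' : (D : ℤ) + p = d + q := by exact_mod_cast hpar
  have h2 : ((min (x - 0) (p * n) : ℕ) : ℤ) - p * Y + (n - Y) +
      (q * Y - ((min (x - (p * n + n)) (q * n) : ℕ) : ℤ)) + D * (n - Y) + d * Y =
      ((min (x - 0) (p * n) : ℕ) : ℤ) - Y - ((min (x - (p * n + n)) (q * n) : ℕ) : ℤ) +
      n * (D + 1) := by
    have : (d : ℤ) = D + p - q := by linarith
    rw [this]; ring
  have h3 : (p : ℤ) * n + n + q * n + n * d = n * (D + 1) + 2 * (p * n) := by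
    have : (d : ℤ) = D + p - q := by linarith
    rw [this]; ring
  rw [h2, h3, hYv]
  generalize (n : ℤ) * (D + 1) = W
  have h4 : (p : ℤ) * n = ((p * n : ℕ) : ℤ) := by push_cast; rfl
  rw [h4]
  generalize p * n = P at *
  generalize q * n = Q at *
  omega

lemma marked_sysM {n p q D d K : ℕ} (hp : 0 < p) (hDK : D ≤ K) (hdK : d ≤ K) (hn : 0 < n)
    (hpar : D + p = d + q) (X : Dat n p q D d) (hX : X.Ok K)
    (hcyc : ∀ y : Fin n, ∃ k : ℕ, (((X.c ⟨0, hp⟩) * X.s) ^ k) y = ⟨0, hn⟩) :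
    IsMarkedSystem (p * n + n + q * n)
      (fun i => (min ((n : ℤ) * (D + 1) + i) (p * n + n + q * n + n * d - i)).toNat)
      (p * n + n + n + q * n + D * n + d * n - 1) (sysM K X) := by
  have hpn : n ≤ p * n := by nlinarith
  have hcard := card_sysM (K := K) hn X
  have hbd : ∀ I ∈ (sysM K X).map Prod.fst, 0 ≤ I.1 ∧ I.1 ≤ I.2 ∧
      I.2 ≤ ((p * n + n + q * n : ℕ) : ℤ) := by
    intro I hI
    obtain ⟨T, hT, rfl⟩ := Multiset.mem_map.1 hI
    obtain ⟨a, b, k, rfl, h1, h2, h3, h4⟩ := bounds_sysM hp hDK hdK hn X hX T hT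
    simp only [tri]
    omega
  have hcov := cover_sysM (K := K) hp hn hpar X
  have h3 : (p : ℤ) * n + n + q * n + n * d = n * (D + 1) + 2 * (p * n) := by
    have : (d : ℤ) = D + p - q := by have : (D : ℤ) + p = d + q := by exact_mod_cast hpar
                                     linarith
    rw [this]; ring
  refine ⟨?_, ⟨hbd, ?_⟩, ?_, by omega⟩
  · intro T hT
    obtain ⟨a, b, k, rfl, h1, h2, h3, h4⟩ := bounds_sysM hp hDK hdK hn X hX T hT
    simp only [tri]
    omega
  · intro i hi0 him
    lift i to ℕ using hi0
    have h1 := hcov i (by exact_mod_cast him)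
    have h2 := congrArg Int.toNat h1
    rw [Int.toNat_natCast] at h2
    exact h2
  · refine admissible_of (p * n + n + q * n) (p * n + n + n + q * n + D * n + d * n - 1)
      (n * (D + 1)) (n * d) (by omega) _ (by rw [Multiset.card_map]; omega) hbd ?_ ?_ ?_ ?_
      (p * n) (by omega) ?_
    · have h1 := hcov 0 (by omega)
      have h4 : (0 : ℤ) ≤ p * n := by positivity
      rw [h3, min_eq_left (by push_cast; linarith)] at h1
      simp only [Nat.cast_zero, add_zero] at h1
      exact_mod_cast h1
    · have h1 := hcov (p * n + n + q * n) le_rfl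
      have h4 : (0 : ℤ) ≤ p * n := by positivity
      have h5 : (0 : ℤ) ≤ q * n := by positivity
      have h6 : (p : ℤ) * n + n + q * n + n * d - ((p * n + n + q * n : ℕ) : ℤ) = n * d := by
        push_cast; ring
      rw [h6, min_eq_right (by push_cast; nlinarith)] at h1
      exact_mod_cast h1
    · have e1 : n * (D + 1) = D * n + n := by ring
      have e2 : n * d = d * n := by ring
      rw [e1, e2]; omega
    · intro I hI
      obtain ⟨T, hT, rfl⟩ := Multiset.mem_map.1 hI
      obtain ⟨a, b, k, rfl, h1, h2, h3, h4⟩ := bounds_sysM hp hDK hdK hn X hX T hT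
      simp only [tri]
      omega
    · set R := (fun a b : ℕ => a < p * n + n + q * n ∧ b < p * n + n + q * n ∧
        (((a : ℤ) + 1, (b : ℤ)) : ℤ × ℤ) ∈ (sysM K X).map Prod.fst) with hR
      have rel : ∀ a b k : ℕ, tri (a + 1) b k ∈ sysM K X → a < p * n + n + q * n →
          b < p * n + n + q * n → R a b := by
        intro a b k h ha hb
        refine ⟨ha, hb, Multiset.mem_map.2 ⟨_, h, ?_⟩⟩
        simp [tri]
      have relA : ∀ (l : Fin p) (x : Fin n), R (l * n + x) (p * n + X.c l x) := by
        intro l x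
        have := blk l.2 x.2
        have := (X.c l x).2
        exact rel _ _ _ ((mem_sysM K X _).2 (Or.inl ⟨(l, x), rfl⟩)) (by omega) (by omega)
      have relS : ∀ y : Fin n, (y : ℕ) ≠ 0 → R (X.s y) (p * n + y) := by
        intro y hy
        exact rel _ _ _ ((mem_sysM K X _).2 (Or.inr (Or.inl ⟨y, hy, rfl⟩))) (by omega) (by omega)
      have relR : ∀ (l : Fin q) (x : Fin n), R (p * n + X.e l x) (p * n + n + (l * n + x)) := by
        intro l x
        have := blk l.2 x.2
        exact rel _ _ _ ((mem_sysM K X _).2 (Or.inr (Or.inr (Or.inr (Or.inl ⟨(l, x), rfl⟩)))))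
          (by omega) (by omega)
      have hY : ∀ (k : ℕ) (y : Fin n), (((X.c ⟨0, hp⟩) * X.s) ^ k) y = ⟨0, hn⟩ →
          Relation.EqvGen R (p * n) (p * n + y) := by
        intro k
        induction k with
        | zero =>
          intro y hy
          simp only [pow_zero, Equiv.Perm.coe_one, id_eq] at hy
          subst hy
          exact Relation.EqvGen.refl _
        | succ k ih =>
          intro y hy
          by_cases hy0 : (y : ℕ) = 0
          · rw [hy0]; exact Relation.EqvGen.refl _
          · rw [pow_succ, Equiv.Perm.mul_apply] at hy
            have h1 := ih _ hy
            refine h1.trans _ _ _ ?_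
            have h2 := relA ⟨0, hp⟩ (X.s y)
            simp only [zero_mul, zero_add] at h2
            exact ((Relation.EqvGen.rel _ _ h2).symm).trans _ _ _ (Relation.EqvGen.rel _ _ (relS y hy0))
      have hY' : ∀ y : Fin n, Relation.EqvGen R (p * n) (p * n + y) := fun y =>
        (hcyc y).elim fun k hk => hY k y hk
      intro i hi
      have hdm := Nat.div_add_mod'
      have hml : ∀ a, a % n < n := fun a => Nat.mod_lt _ hn
      by_cases h1 : i < p * n
      · have h2 := relA ⟨i / n, Nat.div_lt_of_lt_mul (by rwa [mul_comm])⟩ ⟨i % n, hml i⟩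
        simp only [hdm] at h2
        exact (hY' _).trans _ _ _ (Relation.EqvGen.rel _ _ h2).symm
      · by_cases h2 : i < p * n + n
        · have h3 := hY' ⟨i - p * n, by omega⟩
          simp only at h3
          rwa [show p * n + (i - p * n) = i by omega] at h3
        · have h4 : i - (p * n + n) < q * n := by omega
          have h3 := relR ⟨(i - (p * n + n)) / n,
            Nat.div_lt_of_lt_mul (by rw [mul_comm n q]; exact h4)⟩
            ⟨(i - (p * n + n)) % n, hml _⟩
          simp only [hdm] at h3
          rw [show p * n + n + (i - (p * n + n)) = i by omega] at h3
          exact (hY' _).trans _ _ _ (Relation.EqvGen.rel _ _ h3)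

/-- independent parameters of the family -/
abbrev Par (n p q D d K : ℕ) : Type :=
  (Fin p → Equiv.Perm (Fin n)) × (Fin q → Equiv.Perm (Fin n)) ×
  {g : Equiv.Perm (Fin n) // g.cycleType = {n}} ×
  (∀ i : Fin p × Fin n, Fin (n - i.2)) × (∀ y : Fin n, Fin (max (y : ℕ) 1)) ×
  (∀ u : Fin n, Fin ((u : ℕ) + 1)) × (∀ i : Fin q × Fin n, Fin ((i.2 : ℕ) + 1)) ×
  (∀ i : Fin D × Fin n, Fin (max (((i.2 : ℕ) + 1) / K) 1)) ×
  (∀ i : Fin d × Fin n, Fin (max ((n - (i.2 : ℕ)) / K) 1))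

def toDat {n p q D d K : ℕ} (hp : 0 < p) (x : Par n p q D d K) : Dat n p q D d where
  c := x.1
  e := x.2.1
  s := (x.1 ⟨0, hp⟩)⁻¹ * x.2.2.1.1
  oA := fun i => x.2.2.2.1 i
  oS := fun i => x.2.2.2.2.1 i
  oP := fun i => x.2.2.2.2.2.1 i
  oR := fun i => x.2.2.2.2.2.2.1 i
  oa := fun i => x.2.2.2.2.2.2.2.1 i
  ob := fun i => x.2.2.2.2.2.2.2.2 i

lemma toDat_ok {n p q D d K : ℕ} (hp : 0 < p) (x : Par n p q D d K) : (toDat hp x).Ok K where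
  hA := fun i => (x.2.2.2.1 i).2
  hS := fun i => (x.2.2.2.2.1 i).2
  hS0 := fun y hy => by
    have := (x.2.2.2.2.1 y).2
    simp only [toDat]
    omega
  hP := fun i => (x.2.2.2.2.2.1 i).2
  hR := fun i => (x.2.2.2.2.2.2.1 i).2
  ha := fun i => (x.2.2.2.2.2.2.2.1 i).2
  hb := fun i => (x.2.2.2.2.2.2.2.2 i).2

lemma toDat_inj {n p q D d K : ℕ} (hp : 0 < p) :
    Function.Injective (toDat (n := n) (q := q) (D := D) (d := d) (K := K) hp) := by
  rintro ⟨c, e, ⟨g, hg⟩, a1, a2, a3, a4, a5, a6⟩ ⟨c', e', ⟨g', hg'⟩, b1, b2, b3, b4, b5, b6⟩ h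
  simp only [toDat, Dat.mk.injEq] at h
  obtain ⟨rfl, rfl, h1, h2, h3, h4, h5, h6, h7⟩ := h
  have := mul_left_cancel h1
  subst this
  have e1 : a1 = b1 := funext fun i => Fin.ext (congrFun h2 i)
  have e2 : a2 = b2 := funext fun i => Fin.ext (congrFun h3 i)
  have e3 : a3 = b3 := funext fun i => Fin.ext (congrFun h4 i)
  have e4 : a4 = b4 := funext fun i => Fin.ext (congrFun h5 i)
  have e5 : a5 = b5 := funext fun i => Fin.ext (congrFun h6 i)
  have e6 : a6 = b6 := funext fun i => Fin.ext (congrFun h7 i)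
  subst e1 e2 e3 e4 e5 e6
  rfl

lemma cycle_reach {n : ℕ} (hn : 2 ≤ n) (g : Equiv.Perm (Fin n)) (hg : g.cycleType = {n})
    (y z : Fin n) : ∃ k : ℕ, (g ^ k) y = z := by
  have h1 : g.IsCycle := by
    rw [← Equiv.Perm.card_cycleType_eq_one, hg]; simp
  have h2 : g.support = Finset.univ := by
    apply Finset.eq_univ_of_card
    rw [← Equiv.Perm.sum_cycleType, hg]; simp
  have h3 : ∀ x, g x ≠ x := fun x => by
    rw [← Equiv.Perm.mem_support, h2]; exact Finset.mem_univ x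
  exact h1.exists_pow_eq (h3 y) (h3 z)

lemma finite_marked (m : ℕ) (σ : ℤ → ℕ) (t : ℕ) :
    {M : Multiset ((ℤ × ℤ) × ℤ) | IsMarkedSystem m σ t M}.Finite := by
  classical
  let B : Set ((ℤ × ℤ) × ℤ) := (Set.Icc 0 (m : ℤ) ×ˢ Set.Icc 0 (m : ℤ)) ×ˢ Set.Icc 0 (m : ℤ)
  have hB : B.Finite := ((Set.finite_Icc _ _).prod (Set.finite_Icc _ _)).prod (Set.finite_Icc _ _)
  have : Finite B := hB
  refine (((List.finite_length_eq B t).image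
    fun l => (((l.map Subtype.val : List _)) : Multiset ((ℤ × ℤ) × ℤ)))).subset ?_
  rintro M ⟨h1, ⟨h2, -⟩, -, h4⟩
  have hM : ∀ T ∈ M.toList, T ∈ B := by
    intro T hT
    rw [Multiset.mem_toList] at hT
    have a1 := h1 T hT
    have a2 := h2 T.1 (Multiset.mem_map_of_mem _ hT)
    simp only [B, Set.mem_prod, Set.mem_Icc]
    omega
  refine ⟨M.toList.attachWith _ hM, ?_, ?_⟩
  · simp [h4]
  · change (((M.toList.attachWith _ hM).map Subtype.val : List _) :
      Multiset ((ℤ × ℤ) × ℤ)) = M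
    rw [List.attachWith_map_subtype_val, Multiset.coe_toList]

lemma card_par_le {n p q D d K : ℕ} (hp : 0 < p) (hDK : D ≤ K) (hdK : d ≤ K) (hn : 2 ≤ n)
    (hpar : D + p = d + q) :
    Fintype.card (Par n p q D d K) ≤ Set.ncard {M : Multiset ((ℤ × ℤ) × ℤ) |
      IsMarkedSystem (p * n + n + q * n)
      (fun i => (min ((n : ℤ) * (D + 1) + i) (p * n + n + q * n + n * d - i)).toNat)
      (p * n + n + n + q * n + D * n + d * n - 1) M} := by
  rw [← Nat.card_eq_fintype_card, ← Nat.card_coe_set_eq]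
  have := (finite_marked (p * n + n + q * n)
      (fun i => (min ((n : ℤ) * (D + 1) + i) (p * n + n + q * n + n * d - i)).toNat)
      (p * n + n + n + q * n + D * n + d * n - 1)).to_subtype
  have hn0 : 0 < n := by omega
  refine Nat.card_le_card_of_injective (fun x : Par n p q D d K => ⟨sysM K (toDat hp x),
    marked_sysM hp hDK hdK hn0 hpar _ (toDat_ok hp x) (fun y => ?_)⟩) ?_
  · have h := cycle_reach hn x.2.2.1.1 x.2.2.1.2 y ⟨0, hn0⟩
    simpa [toDat] using h
  · intro x x' h
    exact toDat_inj hp (sysM_inj hp hDK hdK hn0 _ _ (toDat_ok hp x) (toDat_ok hp x')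
      (congrArg Subtype.val h))

open Nat in
lemma prod_succ_fin (n : ℕ) : ∏ u : Fin n, ((u : ℕ) + 1) = n ! := by
  rw [Fin.prod_univ_eq_prod_range (fun u => u + 1), Finset.prod_range_add_one_eq_factorial]

open Nat in
lemma prod_sub_fin (n : ℕ) : ∏ u : Fin n, (n - (u : ℕ)) = n ! := by
  rw [← prod_succ_fin, ← Equiv.prod_comp Fin.revPerm]
  apply Finset.prod_congr rfl
  intro u _
  simp [Fin.val_rev]
  omega

open Nat in
lemma prod_max_fin (n : ℕ) (hn : 0 < n) : (∏ u : Fin n, max (u : ℕ) 1) * n = n ! := by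
  rw [Fin.prod_univ_eq_prod_range (fun u => max u 1)]
  obtain ⟨k, rfl⟩ : ∃ k, n = k + 1 := ⟨n - 1, by omega⟩
  clear hn
  induction k with
  | zero => simp
  | succ k ih =>
    rw [Finset.prod_range_succ, Nat.factorial_succ, ← ih]
    simp
    ring

lemma div_bound (N K : ℕ) (hK : 0 < K) : N ≤ max (N / K) 1 * (2 * K) := by
  have h1 := Nat.lt_mul_div_succ N hK
  have h2 : N / K + 1 ≤ 2 * max (N / K) 1 := by omega
  calc N ≤ K * (N / K + 1) := h1.le
    _ ≤ K * (2 * max (N / K) 1) := Nat.mul_le_mul_left _ h2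
    _ = _ := by ring

lemma prod_fin_const {a n : ℕ} (f : Fin n → ℕ) :
    ∏ i : Fin a × Fin n, f i.2 = (∏ y, f y) ^ a := by
  rw [Fintype.prod_prod_type]
  simp

open Nat in
lemma prod_div_a (n K : ℕ) (hK : 0 < K) :
    n ! ≤ (∏ y : Fin n, max (((y : ℕ) + 1) / K) 1) * (2 * K) ^ n := by
  rw [← prod_succ_fin]
  calc _ ≤ ∏ y : Fin n, (max (((y : ℕ) + 1) / K) 1 * (2 * K)) :=
        Finset.prod_le_prod' fun y _ => div_bound _ K hK
    _ = _ := by rw [Finset.prod_mul_distrib]; simp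

open Nat in
lemma prod_div_b (n K : ℕ) (hK : 0 < K) :
    n ! ≤ (∏ y : Fin n, max ((n - (y : ℕ)) / K) 1) * (2 * K) ^ n := by
  rw [← prod_sub_fin]
  calc _ ≤ ∏ y : Fin n, (max ((n - (y : ℕ)) / K) 1 * (2 * K)) :=
        Finset.prod_le_prod' fun y _ => div_bound _ K hK
    _ = _ := by rw [Finset.prod_mul_distrib]; simp

open Nat in
lemma card_par {n p q D d K : ℕ} (hK : 0 < K) (hn : 2 ≤ n) :
    (n !) ^ (2 * p + 2 * q + 3 + D + d) ≤
      Fintype.card (Par n p q D d K) * n ^ 2 * ((2 * K) ^ n) ^ (D + d) := by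
  have hcyc : Fintype.card {g : Equiv.Perm (Fin n) // g.cycleType = {n}} * n = n ! := by
    rw [Fintype.card_subtype, Equiv.Perm.card_of_cycleType_singleton hn (by simp)]
    simp only [Fintype.card_fin, Nat.choose_self, mul_one]
    rw [mul_comm, Nat.mul_factorial_pred (by omega)]
  have hA := prod_fin_const (a := p) (fun y : Fin n => n - (y : ℕ))
  have hR := prod_fin_const (a := q) (fun y : Fin n => (y : ℕ) + 1)
  have ha := prod_fin_const (a := D) (fun y : Fin n => max (((y : ℕ) + 1) / K) 1)
  have hb := prod_fin_const (a := d) (fun y : Fin n => max ((n - (y : ℕ)) / K) 1)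
  rw [prod_sub_fin] at hA
  rw [prod_succ_fin] at hR
  have h1 := Nat.pow_le_pow_left (prod_div_a n K hK) D
  have h2 := Nat.pow_le_pow_left (prod_div_b n K hK) d
  rw [mul_pow, ← ha] at h1
  rw [mul_pow, ← hb] at h2
  have h3 := prod_max_fin n (by omega)
  simp only [Fintype.card_prod, Fintype.card_pi, Fintype.card_fin, Finset.prod_const,
    Finset.card_univ, Fintype.card_perm, prod_succ_fin, hA, hR]
  calc (n !) ^ (2 * p + 2 * q + 3 + D + d)
      = (n !) ^ p * (n !) ^ q * (n !) * (n !) ^ p * (n !) * (n !) * (n !) ^ q *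
        ((n !) ^ D * (n !) ^ d) := by ring
    _ ≤ (n !) ^ p * (n !) ^ q * (n !) * (n !) ^ p * (n !) * (n !) * (n !) ^ q *
        (((∏ i : Fin D × Fin n, max (((i.2 : ℕ) + 1) / K) 1) * ((2 * K) ^ n) ^ D) *
        ((∏ i : Fin d × Fin n, max ((n - (i.2 : ℕ)) / K) 1) * ((2 * K) ^ n) ^ d)) :=
        Nat.mul_le_mul_left _ (Nat.mul_le_mul h1 h2)
    _ = (n !) ^ p * (n !) ^ q *
        (Fintype.card {g : Equiv.Perm (Fin n) // g.cycleType = {n}} * n) * (n !) ^ p *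
        ((∏ u : Fin n, max (u : ℕ) 1) * n) * (n !) * (n !) ^ q *
        (((∏ i : Fin D × Fin n, max (((i.2 : ℕ) + 1) / K) 1) * ((2 * K) ^ n) ^ D) *
        ((∏ i : Fin d × Fin n, max ((n - (i.2 : ℕ)) / K) 1) * ((2 * K) ^ n) ^ d)) := by
        rw [hcyc, h3]
    _ = _ := by ring

open Nat in
lemma log_fact (n : ℕ) (hn : 1 ≤ n) : n * Real.log n - n ≤ Real.log (n ! : ℝ) := by
  have h := Real.pow_div_factorial_le_exp (n : ℝ) (by positivity) n
  have hn' : (0 : ℝ) < n := by exact_mod_cast hn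
  have hf : (0 : ℝ) < (n ! : ℝ) := by exact_mod_cast Nat.factorial_pos n
  have h2 := Real.log_le_log (by positivity) h
  rw [Real.log_exp, Real.log_div (by positivity) (by positivity), Real.log_pow] at h2
  linarith

open Nat in
lemma log_bound (n E F K N : ℕ) (hn : 1 ≤ n) (hK : 1 ≤ K)
    (h : (n !) ^ E ≤ N * n ^ 2 * ((2 * K) ^ n) ^ F) :
    (E : ℝ) * n * Real.log n - (E + 2 + F * Real.log (2 * K)) * n ≤ Real.log N := by
  have hf : (0 : ℝ) < (n ! : ℝ) := by exact_mod_cast Nat.factorial_pos n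
  have hn' : (0 : ℝ) < n := by exact_mod_cast hn
  have hK' : (0 : ℝ) < K := by exact_mod_cast hK
  have hN : 0 < N := by
    rcases Nat.eq_zero_or_pos N with rfl | h0
    · have : 0 < (n !) ^ E := pow_pos (Nat.factorial_pos n) _
      rw [zero_mul, zero_mul] at h
      omega
    · exact h0
  have hN' : (0 : ℝ) < N := by exact_mod_cast hN
  have h1 : ((n ! : ℝ)) ^ E ≤ N * (n : ℝ) ^ 2 * ((2 * (K : ℝ)) ^ n) ^ F := by exact_mod_cast h
  have h2 := Real.log_le_log (by positivity) h1
  rw [Real.log_mul (by positivity) (by positivity), Real.log_mul (by positivity) (by positivity),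
    Real.log_pow, Real.log_pow, Real.log_pow, Real.log_pow] at h2
  have h3 := mul_le_mul_of_nonneg_left (log_fact n hn) (Nat.cast_nonneg (α := ℝ) E)
  have h4 : Real.log n ≤ n := (Real.log_le_sub_one_of_pos hn').trans (by linarith)
  push_cast at h2
  nlinarith

/-- Let `1 ≤ d₂ ≤ d₁ < d`.  There is a constant `C > 0` (depending only on
`d, d₁, d₂`) such that for every `n ≥ 1`, the number `S_n` of marked admissible proper systems
with parameters `m = n(2d - d₁ - d₂)`, `σ(i) = min(n d₁ + i, m + n d₂ - i)`, consisting of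
exactly `2nd - 1` intervals, satisfies `log S_n ≥ (4d - d₁ - d₂) n log n - C n`. -/
theorem statement3 (d d₁ d₂ : ℕ) (hd₂ : 1 ≤ d₂) (hd₁ : d₂ ≤ d₁) (hd : d₁ < d) :
    ∃ C : ℝ, 0 < C ∧ ∀ n : ℕ, 1 ≤ n →
      (4 * (d : ℝ) - d₁ - d₂) * n * Real.log n - C * n ≤
        Real.log (Set.ncard {M : Multiset ((ℤ × ℤ) × ℤ) |
          IsMarkedSystem (n * (2 * d - d₁ - d₂))
            (fun i : ℤ =>
              (min ((n : ℤ) * d₁ + i)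
                ((n * (2 * d - d₁ - d₂) : ℕ) + (n : ℤ) * d₂ - i)).toNat)
            (2 * n * d - 1) M}) := by
  obtain ⟨p, rfl⟩ : ∃ p, d = d₁ + p := ⟨d - d₁, by omega⟩
  obtain ⟨D, rfl⟩ : ∃ D, d₁ = D + 1 := ⟨d₁ - 1, by omega⟩
  obtain ⟨q, hq⟩ : ∃ q, D + p = d₂ + q := ⟨D + p - d₂, by omega⟩
  have hp : 0 < p := by omega
  have hlog : 0 ≤ Real.log (2 * ((D + d₂ : ℕ) : ℝ)) := by
    apply Real.log_nonneg
    have : (1 : ℝ) ≤ ((D + d₂ : ℕ) : ℝ) := by exact_mod_cast (by omega : 1 ≤ D + d₂)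
    linarith
  refine ⟨((2 * p + 2 * q + 3 + D + d₂ : ℕ) : ℝ) + 2 +
    ((D + d₂ : ℕ) : ℝ) * Real.log (2 * ((D + d₂ : ℕ) : ℝ)), by positivity, ?_⟩
  intro n hn
  rcases Nat.lt_or_ge n 2 with h2 | h2
  · obtain rfl : n = 1 := by omega
    have h0 : ∀ k : ℕ, (0 : ℝ) ≤ Real.log k := fun k => Real.log_natCast_nonneg k
    refine le_trans ?_ (h0 _)
    simp only [Nat.cast_one, Real.log_one, mul_zero, zero_sub, mul_one]
    rw [neg_nonpos]
    positivity
  have hm : n * (2 * (D + 1 + p) - (D + 1) - d₂) = p * n + n + q * n := by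
    have : 2 * (D + 1 + p) - (D + 1) - d₂ = p + 1 + q := by omega
    rw [this]; ring
  have ht : 2 * n * (D + 1 + p) - 1 = p * n + n + n + q * n + D * n + d₂ * n - 1 := by
    have : 2 * n * (D + 1 + p) = n * (D + p) + n * (D + p) + 2 * n := by ring
    rw [this]
    nth_rewrite 2 [hq]
    congr 1
    ring
  have hcard := card_par_le (K := D + d₂) (n := n) hp (by omega) (by omega) h2 hq
  have hpow := card_par (n := n) (p := p) (q := q) (D := D) (d := d₂) (K := D + d₂) (by omega) h2
  have hfin := log_bound n _ _ (D + d₂) _ hn (by omega) (hpow.trans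
    (Nat.mul_le_mul_right _ (Nat.mul_le_mul_right _ hcard)))
  rw [hm, ht]
  have hE : 4 * (((D + 1 + p : ℕ)) : ℝ) - ((D + 1 : ℕ) : ℝ) - d₂ =
      ((2 * p + 2 * q + 3 + D + d₂ : ℕ) : ℝ) := by
    have : (D : ℝ) + p = d₂ + q := by exact_mod_cast hq
    push_cast
    linarith
  rw [hE]
  have hσ : (fun i : ℤ => (min ((n : ℤ) * ((D + 1 : ℕ) : ℤ) + i)
      (((p * n + n + q * n : ℕ) : ℤ) + (n : ℤ) * d₂ - i)).toNat) =
      (fun i : ℤ => (min ((n : ℤ) * (D + 1) + i) (p * n + n + q * n + n * d₂ - i)).toNat) := by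
    funext i
    push_cast
    rfl
  rw [hσ]
  exact hfin
end

section
/- Let d, d₁ be integers with 1 ≤ d₁ < d. There exists a constant C > 0 (depending only on d and d₁) such that for every integer n ≥ 1, the number S_n of marked admissible proper systems with parameters m = n(2d − d₁) and σ(i) = min(i, m − i, n(d − d₁)), consisting of exactly n(2d − d₁) − 1 intervals, satisfies log S_n ≥ (4d − 2d₁) n log n − C n. -/
theorem tree_aux {U : Type} [Fintype U] [DecidableEq U] (m : ℕ) (root : U) (par : U → U)
    (rank : U → ℕ) (x : U → ℤ) (I : U → ℤ × ℤ)
    (hcard : Fintype.card U = m)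
    (hrank : ∀ u, u ≠ root → rank (par u) < rank u)
    (hx0 : ∀ u, 0 ≤ x u) (hxm : ∀ u, x u < m) (hinj : Function.Injective x)
    (hI : ∀ u, u ≠ root → ((I u).2 = x u ∧ (I u).1 = x (par u) + 1) ∨
      ((I u).2 = x (par u) ∧ (I u).1 = x u + 1)) :
    IsAdmissible m ((Finset.univ.erase root).val.map I) := by
  classical
  have hm : 1 ≤ m := hcard ▸ Fintype.card_pos_iff.mpr ⟨root⟩
  have hc : Fintype.card {u // u ≠ root} = m - 1 := by
    simp [hcard]
  let e : Fin (m - 1) ≃ {u // u ≠ root} := (Fintype.equivFinOfCardEq hc).symm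
  let f : Fin (m - 1) → ℤ × ℤ := fun j => I (e j).1
  refine ⟨m - 1, f, ?_, ?_⟩
  · have h1 : (List.ofFn f : Multiset (ℤ × ℤ)) = (Finset.univ : Finset (Fin (m-1))).val.map f := by
      rw [Fin.univ_val_map]
    rw [h1]
    have h2 : (Finset.univ.erase root).val = (Finset.univ : Finset (Fin (m-1))).val.map
        (fun j => (e j).1) := by
      have : Finset.univ.erase root = (Finset.univ : Finset (Fin (m-1))).map
          (e.toEmbedding.trans (Function.Embedding.subtype _)) := by
        ext u
        simp only [Finset.mem_erase, Finset.mem_univ, and_true, Finset.mem_map, true_and]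
        constructor
        · intro h
          exact ⟨e.symm ⟨u, h⟩, by simp⟩
        · rintro ⟨j, rfl⟩
          exact (e j).2
      rw [this]; rfl
    rw [h2, Multiset.map_map]; rfl
  · let y : U → Fin m := fun u => ⟨(x u).toNat, by have := hx0 u; have := hxm u; omega⟩
    have hy : ∀ u, ((y u : ℕ) : ℤ) = x u := fun u => by
      have := hx0 u
      simp [y, this]
    have hyb : Function.Bijective y := by
      rw [Fintype.bijective_iff_injective_and_card]
      refine ⟨fun u w h => hinj ?_, by simp [hcard]⟩
      rw [← hy u, ← hy w, h]
    have hadj : ∀ (j : Fin (m-1)) (i : Fin m), (systemGraph m f).Adj (Sum.inl j) (Sum.inr i) ↔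
        ((f j).2 = (i : ℤ) ∨ (f j).1 = (i : ℤ) + 1) := by
      intro j i
      simp [systemGraph, SimpleGraph.fromRel_adj]
    have hA : ∀ u (h : u ≠ root), (systemGraph m f).Adj (Sum.inl (e.symm ⟨u, h⟩)) (Sum.inr (y u)) := by
      intro u h
      rw [hadj, hy]
      simp only [f, Equiv.apply_symm_apply]
      rcases hI u h with h | h
      · exact Or.inl h.1
      · exact Or.inr h.2
    have hB : ∀ u (h : u ≠ root), (systemGraph m f).Adj (Sum.inl (e.symm ⟨u, h⟩))
        (Sum.inr (y (par u))) := by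
      intro u h
      rw [hadj, hy]
      simp only [f, Equiv.apply_symm_apply]
      rcases hI u h with h | h
      · exact Or.inr h.2
      · exact Or.inl h.1
    have hR : ∀ k u, rank u = k → (systemGraph m f).Reachable (Sum.inr (y u)) (Sum.inr (y root)) := by
      intro k
      induction k using Nat.strong_induction_on with
      | _ k ih =>
        intro u hu
        by_cases h : u = root
        · subst h; exact SimpleGraph.Reachable.refl _
        · exact ((hA u h).symm.reachable.trans (hB u h).reachable).trans
            (ih _ (hu ▸ hrank u h) _ rfl)
    have hR' : ∀ v, (systemGraph m f).Reachable v (Sum.inr (y root)) := by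
      rintro (j | i)
      · have := hA (e j).1 (e j).2
        simp only [Subtype.coe_eta, Equiv.symm_apply_apply] at this
        exact this.reachable.trans (hR _ _ rfl)
      · obtain ⟨u, rfl⟩ := hyb.2 i
        exact hR _ _ rfl
    have hconn : (systemGraph m f).Connected := by
      have : Nonempty (Fin (m-1) ⊕ Fin m) := ⟨Sum.inr (y root)⟩
      exact ⟨fun v w => (hR' v).trans (hR' w).symm⟩
    rw [SimpleGraph.isTree_iff_connected_and_card]
    refine ⟨hconn, le_antisymm ?_ hconn.card_vert_le_card_edgeSet_add_one⟩
    let F : Fin (m-1) × Bool → Sym2 (Fin (m-1) ⊕ Fin m) := fun p =>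
      s(Sum.inl p.1, Sum.inr (if p.2 then y (e p.1).1 else y (par (e p.1).1)))
    have hsub : (systemGraph m f).edgeSet ⊆ Set.range F := by
      have key : ∀ j i, (systemGraph m f).Adj (Sum.inl j) (Sum.inr i) →
          s(Sum.inl j, Sum.inr i) ∈ Set.range F := by
        intro j i h
        rw [hadj] at h
        have hcase : i = y (e j).1 ∨ i = y (par (e j).1) := by
          have h3 := hI (e j).1 (e j).2
          have h4 := hy (e j).1
          have h5 := hy (par (e j).1)
          simp only [f] at h
          rw [Fin.ext_iff, Fin.ext_iff]
          rcases h with h | h <;> rcases h3 with h3 | h3 <;> omega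
        rcases hcase with rfl | rfl
        · exact ⟨(j, true), by simp [F]⟩
        · exact ⟨(j, false), by simp [F]⟩
      intro z
      induction z using Sym2.ind with
      | _ a b =>
        intro h
        rw [SimpleGraph.mem_edgeSet] at h
        rcases a with j | i <;> rcases b with j' | i'
        · simp [systemGraph, SimpleGraph.fromRel_adj] at h
        · exact key _ _ h
        · rw [Sym2.eq_swap]; exact key _ _ h.symm
        · simp [systemGraph, SimpleGraph.fromRel_adj] at h
    have h6 : Nat.card (systemGraph m f).edgeSet ≤ (m - 1) * 2 := by
      calc Nat.card (systemGraph m f).edgeSet ≤ Nat.card (Set.range F) :=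
            Nat.card_mono (Set.finite_range F) hsub
        _ ≤ Nat.card (Fin (m-1) × Bool) := Finite.card_range_le F
        _ = (m-1) * 2 := by simp
    have h7 : Nat.card (Fin (m-1) ⊕ Fin m) = (m - 1) + m := by simp
    rw [h7]; omega

theorem finite_aux (m : ℕ) (σ : ℤ → ℕ) (t : ℕ) : Set.Finite {M | IsMarkedSystem m σ t M} := by
  classical
  let B : Finset ((ℤ × ℤ) × ℤ) := (Finset.Icc 0 (m:ℤ) ×ˢ Finset.Icc 0 (m:ℤ)) ×ˢ Finset.Icc 0 (m:ℤ)
  have hfin : (Set.range (fun g : Fin t → B =>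
      (Finset.univ.val.map (fun j => (g j).1) : Multiset ((ℤ × ℤ) × ℤ)))).Finite := Set.finite_range _
  refine hfin.subset ?_
  rintro M ⟨h1, h2, _, h4⟩
  have hB : ∀ p ∈ M, p ∈ B := by
    intro p hp
    have a := h1 p hp
    have b := h2.1 p.1 (Multiset.mem_map_of_mem _ hp)
    simp only [B, Finset.mem_product, Finset.mem_Icc]
    omega
  obtain ⟨L, rfl⟩ := Quot.exists_rep M
  have hL : L.length = t := h4
  subst hL
  refine ⟨fun j => ⟨L.get j, hB _ (by simp)⟩, ?_⟩
  simp only [Fin.univ_val_map]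
  exact congrArg _ (List.ofFn_get L)

theorem sum_type_aux (K q : ℕ) (j : ℕ) (hj : j ≤ 2 * K + q) :
    ∑ v ∈ Finset.range j, (if (v:ℤ) < K then (1:ℤ) else if (v:ℤ) < K + q then 0 else -1) =
      min (min (j:ℤ) ((2 * K + q : ℕ) - j)) K := by
  induction j with
  | zero => simp; omega
  | succ j ih =>
    rw [Finset.sum_range_succ, ih (by omega)]
    split_ifs <;> push_cast <;> omega

theorem cov_aux {U : Type} [Fintype U] [DecidableEq U] (K q : ℕ) (root : U) (par : U → U)
    (up : U → Prop) [DecidablePred up] (x : U → ℤ)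
    (hcard : Fintype.card U = 2 * K + q)
    (hx0 : ∀ u, 0 ≤ x u) (hxm : ∀ u, x u < (2 * K + q : ℕ)) (hinj : Function.Injective x)
    (hlt : ∀ u, u ≠ root → if up u then x (par u) < x u else x u < x (par u))
    (hbal : ∀ g : U → ℤ, ∑ w ∈ Finset.univ.erase root,
        (if up w then g (par w) - g w else g w - g (par w)) =
      ∑ u, (if x u < K then (1:ℤ) else if x u < K + q then 0 else -1) * g u)
    (i : ℤ) (hi0 : 0 ≤ i) (him : i ≤ (2 * K + q : ℕ)) :
    (((Finset.univ.erase root).filter (fun u =>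
      (if up u then x (par u) else x u) < i ∧ i ≤ (if up u then x u else x (par u)))).card : ℤ) =
      min (min i ((2 * K + q : ℕ) - i)) K := by
  obtain ⟨j, rfl⟩ := Int.eq_ofNat_of_zero_le hi0
  have h1 := hbal (fun u => if x u < (j:ℤ) then 1 else 0)
  have h2 : ∑ u, (if x u < K then (1:ℤ) else if x u < K + q then 0 else -1) *
      (if x u < (j:ℤ) then 1 else 0) =
      ∑ v ∈ Finset.range (2 * K + q), (if (v:ℤ) < K then (1:ℤ) else if (v:ℤ) < K + q then 0 else -1) *
      (if (v:ℤ) < (j:ℤ) then 1 else 0) := by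
    let y : U → ℕ := fun u => (x u).toNat
    have hy : ∀ u, ((y u : ℕ) : ℤ) = x u := fun u => by simp [y, hx0 u]
    have hyi : Function.Injective y := fun u w h => hinj (by rw [← hy u, ← hy w, h])
    have him : Finset.univ.image y = Finset.range (2 * K + q) := by
      apply Finset.eq_of_subset_of_card_le
      · intro v hv
        obtain ⟨u, -, rfl⟩ := Finset.mem_image.1 hv
        have := hy u
        have := hxm u
        rw [Finset.mem_range]; omega
      · rw [Finset.card_image_of_injective _ hyi]; simp [hcard]
    rw [← him, Finset.sum_image (fun a _ b _ h => hyi h)]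
    simp only [hy]
  have h3 : ∑ v ∈ Finset.range (2 * K + q), (if (v:ℤ) < K then (1:ℤ) else if (v:ℤ) < K + q then 0 else -1) *
      (if (v:ℤ) < (j:ℤ) then 1 else 0) =
      ∑ v ∈ Finset.range j, (if (v:ℤ) < K then (1:ℤ) else if (v:ℤ) < K + q then 0 else -1) := by
    have hj : j ≤ 2 * K + q := by exact_mod_cast him
    rw [← Finset.sum_subset (Finset.range_subset_range.2 hj)]
    · apply Finset.sum_congr rfl
      intro v hv
      have := Finset.mem_range.1 hv
      rw [if_pos (by exact_mod_cast this : (v:ℤ) < j), mul_one]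
    · intro v _ hv
      have : ¬ (v:ℤ) < j := by
        rw [Finset.mem_range] at hv; exact_mod_cast hv
      rw [if_neg this, mul_zero]
  rw [h2, h3, sum_type_aux K q j (by exact_mod_cast him)] at h1
  rw [← h1, Finset.card_filter]
  push_cast
  apply Finset.sum_congr rfl
  intro w hw
  have := hlt w (Finset.ne_of_mem_erase hw)
  split_ifs at * <;> omega

theorem framework {U β Δ : Type} [Fintype U] [DecidableEq U] [Fintype Δ] (K q : ℕ) (root : U)
    (par : U → U) (rank : U → ℕ) (up : U → Prop) [DecidablePred up] (blk : U → β)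
    (x : Δ → U → ℤ) (mk : Δ → U → ℤ)
    (hcard : Fintype.card U = 2 * K + q)
    (hrank : ∀ u, u ≠ root → rank (par u) < rank u)
    (hblk : ∀ u w, u ≠ root → w ≠ root → blk u = blk w → par u = par w → u = w)
    (hx0 : ∀ δ u, 0 ≤ x δ u) (hxm : ∀ δ u, x δ u < (2 * K + q : ℕ))
    (hinj : ∀ δ, Function.Injective (x δ))
    (hsame : ∀ δ δ' u w, x δ u = x δ' w → blk u = blk w)
    (hroot : ∀ δ δ', x δ root = x δ' root)
    (hup : ∀ δ u, u ≠ root → up u → x δ (par u) < mk δ u ∧ mk δ u ≤ x δ u)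
    (hdn : ∀ δ u, u ≠ root → ¬ up u → x δ u < mk δ u ∧ mk δ u ≤ x δ (par u))
    (hbal : ∀ δ, ∀ g : U → ℤ, ∑ w ∈ Finset.univ.erase root,
        (if up w then g (par w) - g w else g w - g (par w)) =
      ∑ u, (if x δ u < K then (1:ℤ) else if x δ u < K + q then 0 else -1) * g u)
    (hδ : ∀ δ δ', x δ = x δ' → (∀ u, u ≠ root → mk δ u = mk δ' u) → δ = δ') :
    Fintype.card Δ ≤ Set.ncard {M : Multiset ((ℤ × ℤ) × ℤ) | IsMarkedSystem (2 * K + q)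
      (fun i : ℤ => (min (min i ((2 * K + q : ℕ) - i)) (K:ℤ)).toNat) (2 * K + q - 1) M} := by
  classical
  let lo : Δ → U → ℤ := fun δ u => if up u then x δ (par u) else x δ u
  let hi : Δ → U → ℤ := fun δ u => if up u then x δ u else x δ (par u)
  have hlm : ∀ δ u, u ≠ root → lo δ u < mk δ u ∧ mk δ u ≤ hi δ u := by
    intro δ u hu
    simp only [lo, hi]
    split_ifs with h
    · exact hup δ u hu h
    · exact hdn δ u hu h
  let J : Δ → U → (ℤ × ℤ) × ℤ := fun δ u => ((lo δ u + 1, hi δ u), mk δ u)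
  let sys : Δ → Multiset ((ℤ × ℤ) × ℤ) := fun δ => (Finset.univ.erase root).val.map (J δ)
  have hmap : ∀ δ, (sys δ).map Prod.fst =
      (Finset.univ.erase root).val.map (fun u => (lo δ u + 1, hi δ u)) := by
    intro δ
    simp only [sys, Multiset.map_map]; rfl
  have hlo0 : ∀ δ u, 0 ≤ lo δ u := by
    intro δ u; simp only [lo]; split_ifs <;> apply hx0
  have him : ∀ δ u, hi δ u < (2 * K + q : ℕ) := by
    intro δ u; simp only [hi]; split_ifs <;> apply hxm
  have hgood : ∀ δ, sys δ ∈ {M : Multiset ((ℤ × ℤ) × ℤ) | IsMarkedSystem (2 * K + q)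
      (fun i : ℤ => (min (min i ((2 * K + q : ℕ) - i)) (K:ℤ)).toNat) (2 * K + q - 1) M} := by
    intro δ
    refine ⟨?_, ⟨?_, ?_⟩, ?_, ?_⟩
    · intro p hp
      obtain ⟨u, hu, rfl⟩ := Multiset.mem_map.1 hp
      have := hlm δ u (Finset.ne_of_mem_erase hu)
      simp only [J]; omega
    · intro p hp
      rw [hmap] at hp
      obtain ⟨u, hu, rfl⟩ := Multiset.mem_map.1 hp
      have := hlm δ u (Finset.ne_of_mem_erase hu)
      have := hlo0 δ u
      have := him δ u
      simp only []; omega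
    · intro i hi0 hi1
      have h := cov_aux K q root par up (x δ) hcard (hx0 δ) (hxm δ) (hinj δ) (by
        intro u hu
        have := hlm δ u hu
        simp only [lo, hi] at this
        split_ifs at * <;> omega) (hbal δ) i hi0 hi1
      simp only []
      rw [← h, Int.toNat_natCast, hmap, Multiset.filter_map, Multiset.card_map,
        Finset.card_def, Finset.filter_val]
      congr 1
    · rw [hmap]
      apply tree_aux (2 * K + q) root par rank (x δ) _ hcard hrank (hx0 δ) (hxm δ) (hinj δ)
      intro u _
      simp only [lo, hi]
      split_ifs <;> simp
    · simp [sys, hcard]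
  have hsysinj : Function.Injective sys := by
    intro δ δ' hs
    have hE : ∀ u, u ≠ root → ∃ w, w ≠ root ∧ J δ u = J δ' w := by
      intro u hu
      have h1 : J δ u ∈ sys δ := 
        Multiset.mem_map_of_mem _ (Finset.mem_erase.2 ⟨hu, Finset.mem_univ _⟩)
      rw [hs] at h1
      obtain ⟨w, hw, h2⟩ := Multiset.mem_map.1 h1
      exact ⟨w, Finset.ne_of_mem_erase hw, h2.symm⟩
    have hE2 : ∀ u w, J δ u = J δ' w → (x δ u = x δ' w ∧ x δ (par u) = x δ' (par w)) ∨
        (x δ u = x δ' (par w) ∧ x δ (par u) = x δ' w) := by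
      intro u w h
      simp only [J, Prod.mk.injEq, lo, hi] at h
      split_ifs at h <;> omega
    have main : ∀ k u, rank u = k → x δ u = x δ' u ∧ (u ≠ root → mk δ u = mk δ' u) := by
      intro k
      induction k using Nat.strong_induction_on with
      | _ k ih =>
        intro u hu
        by_cases h : u = root
        · subst h; exact ⟨hroot _ _, fun h => absurd rfl h⟩
        · obtain ⟨w, hw, hJ⟩ := hE u h
          have hp := (ih _ (hu ▸ hrank u h) (par u) rfl).1
          have hwu : w = u := by
            rcases hE2 u w hJ with ⟨h1, h2⟩ | ⟨h1, h2⟩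
            · symm
              apply hblk u w h hw (hsame _ _ _ _ h1)
              rw [hp] at h2
              exact hinj _ h2
            · exfalso
              rw [hp] at h2
              have h3 := hinj _ h2
              subst h3
              have h4 := hrank _ hw
              have h5 := hrank _ h
              have h6 := (ih _ (by omega) (par (par u)) rfl).1
              rw [← h6] at h1
              have h7 := hinj _ h1
              rw [← h7] at h4
              omega
          subst hwu
          have hm : mk δ w = mk δ' w := congrArg Prod.snd hJ
          refine ⟨?_, fun _ => hm⟩
          rcases hE2 w w hJ with ⟨h1, h2⟩ | ⟨h1, h2⟩
          · exact h1
          · exfalso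
            rw [hp] at h2
            have h3 := hinj _ h2
            have := hrank w h
            rw [h3] at this
            omega
    exact hδ _ _ (funext fun u => (main _ u rfl).1) (fun u hu => (main _ u rfl).2 hu)
  rw [← Nat.card_eq_fintype_card, ← Set.ncard_univ, ← Set.ncard_image_of_injective _ hsysinj]
  apply Set.ncard_le_ncard _ (finite_aux _ _ _)
  rintro _ ⟨δ, -, rfl⟩
  exact hgood δ

theorem split_aux (F : ℕ → ℤ) (c' f : ℕ) :
    ∑ b ∈ Finset.range ((c' + 2) + f + (c' + 2)), F b =
      ∑ b ∈ Finset.range (c' + 2), F b + F (c' + 2) + ∑ j ∈ Finset.range f, F (c' + 2 + 1 + j)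
        + F (c' + 2 + f + 1) + ∑ j ∈ Finset.range c', F (c' + 2 + f + 2 + j) := by
  rw [show (c' + 2) + f + (c' + 2) = (c' + 2) + (1 + (f + (1 + c'))) by ring]
  rw [Finset.sum_range_add, Finset.sum_range_add (fun x => F (c' + 2 + x)),
    Finset.sum_range_add (fun x => F (c' + 2 + (1 + x))),
    Finset.sum_range_add (fun x => F (c' + 2 + (1 + (f + x))))]
  simp only [Finset.sum_range_one, add_zero]
  rw [show c' + 2 + (1 + f) = c' + 2 + f + 1 by ring]
  have e1 : ∀ j, c' + 2 + (1 + j) = c' + 2 + 1 + j := fun j => by ring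
  have e2 : ∀ j, c' + 2 + (1 + (f + (1 + j))) = c' + 2 + f + 2 + j := fun j => by ring
  simp only [e2, e1]
  ring

theorem split_aux2 (F : ℕ → ℤ) (a s : ℕ) :
    ∑ b ∈ Finset.range ((a + 1) + s + (a + 1)), F b =
      F 0 + ∑ b ∈ Finset.range a, F (b + 1) + ∑ j ∈ Finset.range s, F (a + 1 + j)
        + F (a + 1 + s) + ∑ j ∈ Finset.range a, F (a + 1 + s + 1 + j) := by
  rw [show (a + 1) + s + (a + 1) = (a + 1) + (s + (1 + a)) by ring]
  rw [Finset.sum_range_add, Finset.sum_range_succ' F a, Finset.sum_range_add (fun x => F (a + 1 + x)),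
    Finset.sum_range_add (fun x => F (a + 1 + (s + x)))]
  simp only [Finset.sum_range_one, add_zero]
  have e1 : ∀ j, a + 1 + (s + j) = a + 1 + s + j := fun j => by ring
  have e2 : ∀ j, a + 1 + s + (1 + j) = a + 1 + s + 1 + j := fun j => by ring
  simp only [e1, e2]
  ring

theorem bal_nat (c' f' h' a s' : ℕ) (c f h kr qr : ℕ) (hc : c = c' + 2) (hf : f = f' + 2)
    (hh : h = h' + 1) (hkr : kr = a + 1) (hqr : qr = s' + 1) (G : ℕ → ℕ → ℤ) (H : ℕ → ℤ) :
    ∑ b ∈ Finset.range (c + f + c), ∑ i ∈ Finset.range h,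
      (if c < b then (if b ≤ c + f then G (b - 1) i else if b = c + f + 1 then G (c + 1) i else G c i)
          - G b i
        else G b i - (if b < c then G c i else if i = 0 then H kr else G (c + 1) (i - 1))) +
    ∑ v ∈ Finset.range (kr + qr + kr),
      (if kr ≤ v then (if v = kr then H kr else if v ≤ kr + qr then H (v - 1) else H kr) - H v
        else H v - (if v = 0 then G (c + 1) (h - 1) else H kr)) =
    ∑ b ∈ Finset.range (c + f + c), ∑ i ∈ Finset.range h,
      (if b < c then 1 else if b < c + f then 0 else -1) * G b i +
    ∑ v ∈ Finset.range (kr + qr + kr),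
      (if v < kr then 1 else if v < kr + qr then 0 else -1) * H v := by
  set S : ℕ → ℤ := fun b => ∑ i ∈ Finset.range h, G b i with hS
  have L1 : ∑ b ∈ Finset.range (c + f + c), ∑ i ∈ Finset.range h,
      (if c < b then (if b ≤ c + f then G (b - 1) i else if b = c + f + 1 then G (c + 1) i else G c i)
          - G b i
        else G b i - (if b < c then G c i else if i = 0 then H kr else G (c + 1) (i - 1))) =
      ∑ b ∈ Finset.range c, S b - S c * c + (S c - H kr - S (c + 1) + G (c + 1) h') + (S c - S (c + f))
       + (S (c + 1) - S (c + f + 1)) + (c' * S c - ∑ j ∈ Finset.range c', S (c + f + 2 + j)) := by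
    subst hc
    rw [split_aux]
    congr 1
    congr 1
    congr 1
    congr 1
    · rw [mul_comm (S (c' + 2))]
      rw [show ((c' + 2 : ℕ) : ℤ) * S (c' + 2) = ∑ b ∈ Finset.range (c' + 2), S (c' + 2) by simp]
      rw [← Finset.sum_sub_distrib]
      apply Finset.sum_congr rfl
      intro b hb
      have hb := Finset.mem_range.1 hb
      simp only [hS]
      rw [← Finset.sum_sub_distrib]
      apply Finset.sum_congr rfl
      intro i _
      rw [if_neg (by omega), if_pos hb]
    · subst hh
      simp only [lt_irrefl, if_false, Finset.sum_sub_distrib]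
      rw [Finset.sum_range_succ' (fun i => if i = 0 then H kr else G (c' + 2 + 1) (i - 1))]
      simp only [Nat.add_eq_zero_iff, one_ne_zero, and_false, if_false, if_true, Nat.add_sub_cancel, hS]
      rw [Finset.sum_range_succ (fun i => G (c' + 2 + 1) i)]
      ring
    · have : ∀ N, N ≤ f → ∑ j ∈ Finset.range N, ∑ i ∈ Finset.range h,
          (if c' + 2 < c' + 2 + 1 + j then (if c' + 2 + 1 + j ≤ c' + 2 + f then G (c' + 2 + 1 + j - 1) i
            else if c' + 2 + 1 + j = c' + 2 + f + 1 then G (c' + 2 + 1) i else G (c' + 2) i)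
            - G (c' + 2 + 1 + j) i
          else G (c' + 2 + 1 + j) i - (if c' + 2 + 1 + j < c' + 2 then G (c' + 2) i else
            if i = 0 then H kr else G (c' + 2 + 1) (i - 1))) = S (c' + 2) - S (c' + 2 + N) := by
        intro N
        induction N with
        | zero => simp
        | succ N ih =>
          intro hN
          rw [Finset.sum_range_succ, ih (by omega)]
          simp only [if_pos (by omega : c' + 2 < c' + 2 + 1 + N),
            if_pos (by omega : c' + 2 + 1 + N ≤ c' + 2 + f)]
          rw [Finset.sum_sub_distrib,
            show c' + 2 + 1 + N - 1 = c' + 2 + N by omega,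
            show c' + 2 + 1 + N = c' + 2 + (N + 1) by omega]
          simp only [hS]
          ring
      exact this f le_rfl
    · simp only [if_pos (by omega : c' + 2 < c' + 2 + f + 1),
        if_neg (by omega : ¬ c' + 2 + f + 1 ≤ c' + 2 + f), if_true]
      rw [Finset.sum_sub_distrib]
    · rw [show (c' : ℤ) * S (c' + 2) = ∑ b ∈ Finset.range c', S (c' + 2) by simp]
      rw [← Finset.sum_sub_distrib]
      apply Finset.sum_congr rfl
      intro b hb
      simp only [if_pos (by omega : c' + 2 < c' + 2 + f + 2 + b),
        if_neg (by omega : ¬ c' + 2 + f + 2 + b ≤ c' + 2 + f),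
        if_neg (by omega : ¬ c' + 2 + f + 2 + b = c' + 2 + f + 1)]
      rw [Finset.sum_sub_distrib]
  have L2 : ∑ v ∈ Finset.range (kr + qr + kr),
      (if kr ≤ v then (if v = kr then H kr else if v ≤ kr + qr then H (v - 1) else H kr) - H v
        else H v - (if v = 0 then G (c + 1) (h - 1) else H kr)) =
      (H 0 - G (c + 1) h') + (∑ v ∈ Finset.range a, H (v + 1) - a * H kr) + (H kr - H (kr + s'))
      + (H (kr + s') - H (kr + qr)) + (a * H kr - ∑ v ∈ Finset.range a, H (kr + qr + 1 + v)) := by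
    subst hkr
    rw [split_aux2]
    congr 1
    congr 1
    congr 1
    congr 1
    · simp [hh]
    · rw [show (a : ℤ) * H (a + 1) = ∑ b ∈ Finset.range a, H (a + 1) by simp]
      rw [← Finset.sum_sub_distrib]
      apply Finset.sum_congr rfl
      intro b hb
      have hb := Finset.mem_range.1 hb
      rw [if_neg (by omega), if_neg (by omega)]
    · have : ∀ N, N ≤ s' → ∑ j ∈ Finset.range (N + 1), 
          (if a + 1 ≤ a + 1 + j then (if a + 1 + j = a + 1 then H (a + 1) else
            if a + 1 + j ≤ a + 1 + qr then H (a + 1 + j - 1) else H (a + 1)) - H (a + 1 + j)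
          else H (a + 1 + j) - (if a + 1 + j = 0 then G (c + 1) (h - 1) else H (a + 1))) =
          H (a + 1) - H (a + 1 + N) := by
        intro N
        induction N with
        | zero => simp
        | succ N ih =>
          intro hN
          rw [Finset.sum_range_succ, ih (by omega), if_pos (by omega), if_neg (by omega),
            if_pos (by omega), show a + 1 + (N + 1) - 1 = a + 1 + N by omega]
          ring
      rw [hqr]
      rw [hqr] at this
      exact this s' le_rfl
    · rw [if_pos (by omega), if_neg (by omega), if_pos (by omega),
        show a + 1 + qr - 1 = a + 1 + s' by omega]
    · rw [show (a : ℤ) * H (a + 1) = ∑ b ∈ Finset.range a, H (a + 1) by simp]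
      rw [← Finset.sum_sub_distrib]
      apply Finset.sum_congr rfl
      intro b hb
      rw [if_pos (by omega), if_neg (by omega), if_neg (by omega)]
  have R1 : ∑ b ∈ Finset.range (c + f + c), ∑ i ∈ Finset.range h,
      (if b < c then 1 else if b < c + f then 0 else -1) * G b i =
      ∑ b ∈ Finset.range c, S b - S (c + f) - S (c + f + 1) - ∑ j ∈ Finset.range c', S (c + f + 2 + j) := by
    simp only [← Finset.mul_sum]
    rw [Finset.sum_range_add, Finset.sum_range_add]
    have e1 : ∑ x ∈ Finset.range c, (if x < c then 1 else if x < c + f then 0 else -1) *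
        ∑ i ∈ Finset.range h, G x i = ∑ b ∈ Finset.range c, S b := by
      apply Finset.sum_congr rfl
      intro b hb
      rw [if_pos (Finset.mem_range.1 hb), one_mul]
    have e2 : ∑ x ∈ Finset.range f, (if c + x < c then 1 else if c + x < c + f then 0 else -1) *
        ∑ i ∈ Finset.range h, G (c + x) i = 0 := by
      apply Finset.sum_eq_zero
      intro b hb
      have := Finset.mem_range.1 hb
      rw [if_neg (by omega), if_pos (by omega), zero_mul]
    have e3 : ∑ x ∈ Finset.range c, (if c + f + x < c then 1 else if c + f + x < c + f then 0 else -1) *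
        ∑ i ∈ Finset.range h, G (c + f + x) i = - ∑ x ∈ Finset.range c, S (c + f + x) := by
      rw [← Finset.sum_neg_distrib]
      apply Finset.sum_congr rfl
      intro b hb
      rw [if_neg (by omega), if_neg (by omega), neg_one_mul]
    rw [e1, e2, e3]
    have e4 : ∑ x ∈ Finset.range c, S (c + f + x) = S (c + f) + S (c + f + 1) +
        ∑ j ∈ Finset.range c', S (c + f + 2 + j) := by
      rw [show Finset.range c = Finset.range (2 + c') by rw [hc, add_comm],
        Finset.sum_range_add, Finset.sum_range_succ, Finset.sum_range_one]
      simp only [add_zero, add_assoc]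
    rw [e4]; ring
  have R2 : ∑ v ∈ Finset.range (kr + qr + kr),
      (if v < kr then 1 else if v < kr + qr then 0 else -1) * H v =
      H 0 + ∑ v ∈ Finset.range a, H (v + 1) - H (kr + qr) - ∑ v ∈ Finset.range a, H (kr + qr + 1 + v) := by
    subst hkr
    rw [split_aux2]
    have e1 : ∑ b ∈ Finset.range a, (if b + 1 < a + 1 then 1 else if b + 1 < a + 1 + qr then 0 else -1) *
        H (b + 1) = ∑ v ∈ Finset.range a, H (v + 1) := by
      apply Finset.sum_congr rfl
      intro b hb
      have := Finset.mem_range.1 hb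
      rw [if_pos (by omega), one_mul]
    have e2 : ∑ b ∈ Finset.range qr, (if a + 1 + b < a + 1 then 1 else
        if a + 1 + b < a + 1 + qr then 0 else -1) * H (a + 1 + b) = 0 := by
      apply Finset.sum_eq_zero
      intro b hb
      have := Finset.mem_range.1 hb
      rw [if_neg (by omega), if_pos (by omega), zero_mul]
    have e3 : ∑ b ∈ Finset.range a, (if a + 1 + qr + 1 + b < a + 1 then 1 else
        if a + 1 + qr + 1 + b < a + 1 + qr then 0 else -1) * H (a + 1 + qr + 1 + b) =
        - ∑ b ∈ Finset.range a, H (a + 1 + qr + 1 + b) := by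
      rw [← Finset.sum_neg_distrib]
      apply Finset.sum_congr rfl
      intro b hb
      rw [if_neg (by omega), if_neg (by omega), neg_one_mul]
    rw [e1, e2, e3, if_pos (by omega), if_neg (by omega), if_neg (by omega)]
    ring
  rw [L1, L2, R1, R2]
  rw [hc]; push_cast; ring

/-- abstract vertices: `T × h` block vertices and the leftover vertices. -/
abbrev VV (c f h kr qr : ℕ) : Type := (Fin (c + f + c) × Fin h) ⊕ Fin (kr + qr + kr)

/-- parent function. -/
def vpar (c f h kr qr : ℕ) (hc : 2 ≤ c) (hh : 1 ≤ h) (hk : 1 ≤ kr) :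
    VV c f h kr qr → VV c f h kr qr
  | Sum.inl (b, i) =>
    if c < b.1 then
      (if b.1 ≤ c + f then Sum.inl (⟨b.1 - 1, by omega⟩, i)
        else if b.1 = c + f + 1 then Sum.inl (⟨c + 1, by omega⟩, i)
        else Sum.inl (⟨c, by omega⟩, i))
    else
      (if b.1 < c then Sum.inl (⟨c, by omega⟩, i)
        else if i.1 = 0 then Sum.inr ⟨kr, by omega⟩
        else Sum.inl (⟨c + 1, by omega⟩, ⟨i.1 - 1, by omega⟩))
  | Sum.inr v =>
    if kr ≤ v.1 then
      (if v.1 = kr then Sum.inr ⟨kr, by omega⟩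
        else if v.1 ≤ kr + qr then Sum.inr ⟨v.1 - 1, by omega⟩
        else Sum.inr ⟨kr, by omega⟩)
    else
      (if v.1 = 0 then Sum.inl (⟨c + 1, by omega⟩, ⟨h - 1, by omega⟩)
        else Sum.inr ⟨kr, by omega⟩)

/-- right-child predicate, as a Boolean. -/
def vup (c f h kr qr : ℕ) : VV c f h kr qr → Bool
  | Sum.inl (b, _) => decide (c < b.1)
  | Sum.inr v => decide (kr ≤ v.1)

/-- rank function. -/
def vrank (c f h kr qr : ℕ) : VV c f h kr qr → ℕ
  | Sum.inl (b, i) => 2 * (i.1 + 1) + (if b.1 < c then 1 else b.1 - c)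
  | Sum.inr v => if v.1 < kr then 2 * h + 2 else v.1 - kr

/-- block of a vertex. -/
def vblk (c f h kr qr : ℕ) : VV c f h kr qr → Fin (c + f + c) ⊕ Fin (kr + qr + kr)
  | Sum.inl (b, _) => Sum.inl b
  | Sum.inr v => Sum.inr v

/-- the data of a labelling and marking. -/
abbrev VD (c f h : ℕ) : Type :=
  Fin (c + f + c) → Equiv.Perm (Fin h) × ((y : Fin h) → Fin (y.1 + 1))

/-- start of a block. -/
def vbase (c f h kr qr b : ℕ) : ℕ :=
  b * h + (if b < c then 0 else if b < c + f then kr else kr + qr)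

/-- position of a leftover vertex. -/
def vleft (c f h kr qr v : ℕ) : ℕ :=
  v + (if v < kr then c * h else if v < kr + qr then c * h + f * h else c * h + f * h + c * h)

/-- positions. -/
def vpos (c f h kr qr : ℕ) (δ : VD c f h) : VV c f h kr qr → ℤ
  | Sum.inl (b, i) =>
    if c < b.1 then (vbase c f h kr qr b.1 : ℤ) + ((δ b).1 i).1
    else (vbase c f h kr qr b.1 : ℤ) + (h - 1 - ((δ b).1 i).1)
  | Sum.inr v => vleft c f h kr qr v.1

/-- marks. -/
def vmk (c f h kr qr : ℕ) (δ : VD c f h) : VV c f h kr qr → ℤ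
  | Sum.inl (b, i) =>
    if c < b.1 then vpos c f h kr qr δ (Sum.inl (b, i)) - ((δ b).2 ((δ b).1 i)).1
    else vpos c f h kr qr δ (Sum.inl (b, i)) + 1 + ((δ b).2 ((δ b).1 i)).1
  | Sum.inr v =>
    if kr ≤ v.1 then vleft c f h kr qr v.1 else vleft c f h kr qr v.1 + 1

theorem vfacts (c f h b : ℕ) (hb : b < c + f + c) :
    (b < c → b * h + h ≤ c * h) ∧ (c ≤ b → c * h ≤ b * h) ∧ (b < c + f → b * h + h ≤ c * h + f * h) ∧
    (c + f ≤ b → c * h + f * h ≤ b * h) ∧ b * h + h ≤ c * h + f * h + c * h := by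
  refine ⟨fun h => ?_, fun h => ?_, fun h => ?_, fun h => ?_, ?_⟩ <;> nlinarith

theorem vbase_mono (c f h kr qr b b' : ℕ) (hb : b < b') :
    vbase c f h kr qr b + h ≤ vbase c f h kr qr b' := by
  have : b * h + h ≤ b' * h := by nlinarith
  simp only [vbase]
  split_ifs <;> omega

theorem vpos_bd (c f h kr qr : ℕ) (δ : VD c f h) (b : Fin (c + f + c)) (i : Fin h) :
    (vbase c f h kr qr b.1 : ℤ) ≤ vpos c f h kr qr δ (Sum.inl (b, i)) ∧
    vpos c f h kr qr δ (Sum.inl (b, i)) < (vbase c f h kr qr b.1 : ℤ) + h := by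
  have := ((δ b).1 i).2
  simp only [vpos]
  split_ifs <;> omega

theorem vmk_bd (c f h kr qr : ℕ) (δ : VD c f h) (b : Fin (c + f + c)) (i : Fin h) :
    (c < b.1 → (vbase c f h kr qr b.1 : ℤ) ≤ vmk c f h kr qr δ (Sum.inl (b, i)) ∧
      vmk c f h kr qr δ (Sum.inl (b, i)) ≤ vpos c f h kr qr δ (Sum.inl (b, i))) ∧
    (¬ c < b.1 → vpos c f h kr qr δ (Sum.inl (b, i)) < vmk c f h kr qr δ (Sum.inl (b, i)) ∧
      vmk c f h kr qr δ (Sum.inl (b, i)) ≤ (vbase c f h kr qr b.1 : ℤ) + h) := by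
  have h1 := ((δ b).1 i).2
  have h2 := ((δ b).2 ((δ b).1 i)).2
  constructor
  · intro h
    simp only [vmk, vpos, if_pos h]
    omega
  · intro h
    simp only [vmk, vpos, if_neg h]
    omega

theorem inst_count (c f h kr qr : ℕ) (hc : 2 ≤ c) (hf : 2 ≤ f) (hh : 1 ≤ h) (hk : 1 ≤ kr)
    (hq : 1 ≤ qr) (K q : ℕ) (hK : K = c * h + kr) (hqq : q = f * h + qr) :
    (h.factorial * h.factorial) ^ (c + f + c) ≤
    Set.ncard {M : Multiset ((ℤ × ℤ) × ℤ) | IsMarkedSystem (2 * K + q)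
      (fun i : ℤ => (min (min i ((2 * K + q : ℕ) - i)) (K:ℤ)).toNat) (2 * K + q - 1) M} := by
  have hD : Fintype.card (VD c f h) = (h.factorial * h.factorial) ^ (c + f + c) := by
    simp only [VD, Fintype.card_pi, Fintype.card_prod, Fintype.card_perm, Fintype.card_fin,
      Finset.prod_const, Finset.card_univ]
    congr 2
    rw [← Finset.prod_range_add_one_eq_factorial, Finset.prod_range]
  rw [← hD]
  have hinl : ∀ δ b i, vpos c f h kr qr δ (Sum.inl (b, i)) < vbase c f h kr qr b.1 + h ∧
      (vbase c f h kr qr b.1 : ℤ) ≤ vpos c f h kr qr δ (Sum.inl (b, i)) := fun δ b i =>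
    ⟨(vpos_bd c f h kr qr δ b i).2, (vpos_bd c f h kr qr δ b i).1⟩
  have hsame : ∀ (δ δ' : VD c f h) (u w : VV c f h kr qr),
      vpos c f h kr qr δ u = vpos c f h kr qr δ' w → vblk c f h kr qr u = vblk c f h kr qr w := by
    have mix : ∀ (δ : VD c f h) (b : Fin (c + f + c)) (i : Fin h) (v : Fin (kr + qr + kr)),
        vpos c f h kr qr δ (Sum.inl (b, i)) ≠ vleft c f h kr qr v.1 := by
      intro δ b i v he
      have h1 := vpos_bd c f h kr qr δ b i
      have h2 := vfacts c f h b.1 b.2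
      have h3 := v.2
      rw [he] at h1
      simp only [vbase, vleft] at h1
      split_ifs at h1 <;> omega
    rintro δ δ' (⟨b, i⟩ | v) (⟨b', i'⟩ | v') he
    · have h1 := vpos_bd c f h kr qr δ b i
      have h2 := vpos_bd c f h kr qr δ' b' i'
      simp only [vblk, Sum.inl.injEq]
      rcases lt_trichotomy b.1 b'.1 with hl | hl | hl
      · have := vbase_mono c f h kr qr _ _ hl
        omega
      · exact Fin.ext hl
      · have := vbase_mono c f h kr qr _ _ hl
        omega
    · exact absurd he (mix _ _ _ _)
    · exact absurd he.symm (mix _ _ _ _)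
    · simp only [vblk, Sum.inr.injEq]
      simp only [vpos, vleft] at he
      apply Fin.ext
      split_ifs at he <;> omega
  refine framework K q (Sum.inr ⟨kr, by omega⟩ : VV c f h kr qr) (vpar c f h kr qr hc hh hk)
    (vrank c f h kr qr) (fun u => vup c f h kr qr u = true) (vblk c f h kr qr)
    (vpos c f h kr qr) (vmk c f h kr qr) ?_ ?_ ?_ ?_ ?_ ?_ hsame ?_ ?_ ?_ ?_ ?_
  · simp only [Fintype.card_sum, Fintype.card_prod, Fintype.card_fin, hK, hqq]
    ring
  · -- rank
    rintro (⟨b, i⟩ | v) hu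
    · have := b.2
      have := i.2
      simp only [vpar]
      split_ifs <;> simp only [vrank] <;> split_ifs <;> omega
    · have := v.2
      have hv : v.1 ≠ kr := fun h => hu (congrArg Sum.inr (Fin.ext h))
      simp only [vpar]
      split_ifs <;> simp only [vrank] <;> split_ifs <;> omega
  · -- blocks
    rintro (⟨b, i⟩ | v) (⟨b', i'⟩ | v') hu hw hb hp
    · simp only [vblk, Sum.inl.injEq] at hb
      subst hb
      simp only [vpar] at hp
      split_ifs at hp <;> simp_all [Fin.ext_iff] <;> omega
    · simp [vblk] at hb
    · simp [vblk] at hb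
    · simpa [vblk] using hb
  · intro δ u
    rcases u with ⟨b, i⟩ | v
    · have := vpos_bd c f h kr qr δ b i
      omega
    · simp only [vpos]; omega
  · intro δ u
    have e : 2 * K + q = c * h + f * h + c * h + (kr + qr + kr) := by rw [hK, hqq]; ring
    rw [e]
    rcases u with ⟨b, i⟩ | v
    · have h1 := vpos_bd c f h kr qr δ b i
      have h2 := vfacts c f h b.1 b.2
      simp only [vbase] at h1
      split_ifs at h1 <;> omega
    · have := v.2
      simp only [vpos, vleft]
      split_ifs <;> omega
  · intro δ u w he
    have hb := hsame δ δ u w he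
    rcases u with ⟨b, i⟩ | v <;> rcases w with ⟨b', i'⟩ | v'
    · simp only [vblk, Sum.inl.injEq] at hb
      subst hb
      have : (δ b).1 i = (δ b).1 i' := by
        simp only [vpos] at he
        apply Fin.ext
        split_ifs at he <;> omega
      rw [(δ b).1.injective this]
    · simp [vblk] at hb
    · simp [vblk] at hb
    · simpa [vblk] using hb
  · intro δ δ'; rfl
  · -- right children
    rintro δ (⟨b, i⟩ | v) hu hup
    · have hb : c < b.1 := by simpa [vup] using hup
      have h1 := (vmk_bd c f h kr qr δ b i).1 hb
      refine ⟨lt_of_lt_of_le ?_ h1.1, h1.2⟩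
      have key : ∀ (b' : Fin (c + f + c)), b'.1 < b.1 →
          vpos c f h kr qr δ (Sum.inl (b', i)) < vbase c f h kr qr b.1 := by
        intro b' hb'
        have h2 := (vpos_bd c f h kr qr δ b' i).2
        have h3 := vbase_mono c f h kr qr _ _ hb'
        omega
      simp only [vpar, if_pos hb]
      split_ifs
      · exact key _ (by simp only []; omega)
      · exact key _ (by simp only []; omega)
      · exact key _ (by simp only []; omega)
    · have hv : kr ≤ v.1 := by simpa [vup] using hup
      have hv' : v.1 ≠ kr := fun h => hu (congrArg Sum.inr (Fin.ext h))
      simp only [vpar, vmk, if_pos hv, if_neg hv', vpos, le_refl, and_true]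
      split_ifs <;> simp only [vpos, vleft] <;> split_ifs <;> omega
  · -- left children
    rintro δ (⟨b, i⟩ | v) hu hup
    · have hb : ¬ c < b.1 := by simpa [vup] using hup
      have h1 := (vmk_bd c f h kr qr δ b i).2 hb
      refine ⟨h1.1, le_trans h1.2 ?_⟩
      have key : ∀ (b' : Fin (c + f + c)) (j : Fin h), b.1 < b'.1 →
          (vbase c f h kr qr b.1 : ℤ) + h ≤ vpos c f h kr qr δ (Sum.inl (b', j)) := by
        intro b' j hb'
        have h2 := (vpos_bd c f h kr qr δ b' j).1
        have h3 := vbase_mono c f h kr qr _ _ hb'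
        omega
      simp only [vpar, if_neg hb]
      split_ifs
      · exact key _ _ (by simp only []; omega)
      · have hbc : b.1 = c := by omega
        have : h ≤ f * h := by nlinarith
        simp only [vpos, vleft, vbase, hbc]
        split_ifs <;> omega
      · exact key _ _ (by simp only []; omega)
    · have hv : ¬ kr ≤ v.1 := by simpa [vup] using hup
      simp only [vpar, vmk, if_neg hv]
      refine ⟨by simp only [vpos]; omega, ?_⟩
      split_ifs with h0
      · have h2 := (vpos_bd c f h kr qr δ ⟨c + 1, by omega⟩ ⟨h - 1, by omega⟩).1
        refine le_trans ?_ h2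
        have : (c + 1) * h = c * h + h := by ring
        simp only [vleft, vbase]
        split_ifs <;> omega
      · simp only [vpos, vleft]
        split_ifs <;> omega
  · -- balance
    intro δ g
    rw [Finset.sum_erase]
    swap
    · simp [vup, vpar]
    let G : ℕ → ℕ → ℤ := fun b i =>
      if hx : b < c + f + c ∧ i < h then g (Sum.inl (⟨b, hx.1⟩, ⟨i, hx.2⟩)) else 0
    let H : ℕ → ℤ := fun v => if hx : v < kr + qr + kr then g (Sum.inr ⟨v, hx⟩) else 0
    have hG : ∀ (b : ℕ) (i : ℕ) (hb : b < c + f + c) (hi : i < h),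
        g (Sum.inl (⟨b, hb⟩, ⟨i, hi⟩)) = G b i := by
      intro b i hb hi
      simp only [G]
      rw [dif_pos ⟨hb, hi⟩]
    have hH : ∀ (v : ℕ) (hv : v < kr + qr + kr), g (Sum.inr ⟨v, hv⟩) = H v := by
      intro v hv
      simp only [H]
      rw [dif_pos hv]
    have hN := bal_nat (c - 2) (f - 2) (h - 1) (kr - 1) (qr - 1) c f h kr qr (by omega) (by omega)
      (by omega) (by omega) (by omega) G H
    simp only [Finset.sum_range] at hN
    rw [Fintype.sum_sum_type, Fintype.sum_sum_type, Fintype.sum_prod_type, Fintype.sum_prod_type]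
    convert hN using 2
    · apply Finset.sum_congr rfl
      rintro ⟨b, hb⟩ _
      apply Finset.sum_congr rfl
      rintro ⟨i, hi⟩ _
      simp only [vup, vpar, decide_eq_true_eq]
      split_ifs <;> simp only [hG, hH]
    · apply Finset.sum_congr rfl
      rintro ⟨v, hv⟩ _
      simp only [vup, vpar, decide_eq_true_eq]
      split_ifs <;> simp only [hG, hH]
    · apply Finset.sum_congr rfl
      rintro ⟨b, hb⟩ _
      apply Finset.sum_congr rfl
      rintro ⟨i, hi⟩ _
      rw [hG]
      congr 1
      have h1 := vpos_bd c f h kr qr δ ⟨b, hb⟩ ⟨i, hi⟩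
      have h2 := vfacts c f h b hb
      simp only [vbase] at h1
      subst hK hqq
      push_cast
      split_ifs at h1 ⊢ <;> omega
    · apply Finset.sum_congr rfl
      rintro ⟨v, hv⟩ _
      rw [hH]
      congr 1
      have n1 : 0 ≤ (c : ℤ) * h := by positivity
      have n2 : 0 ≤ (f : ℤ) * h := by positivity
      simp only [vpos, vleft]
      subst hK hqq
      push_cast
      split_ifs <;> omega
  · -- injectivity of the data
    intro δ δ' hx hm
    funext b
    have h1 : (δ b).1 = (δ' b).1 := by
      ext i
      have := congrFun hx (Sum.inl (b, i))
      simp only [vpos] at this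
      split_ifs at this <;> omega
    refine Prod.ext h1 ?_
    funext y
    obtain ⟨i, rfl⟩ := (δ b).1.surjective y
    apply Fin.ext
    have h2 := hm (Sum.inl (b, i)) (by simp)
    have h3 := congrFun hx (Sum.inl (b, i))
    simp only [vmk] at h2
    rw [h3, ← h1] at h2
    split_ifs at h2 <;> omega

theorem log_factorial_aux (n h : ℕ) (hh : 1 ≤ h) (h1 : n ≤ 2 * h + 2) (h2 : 2 * h ≤ n) :
    (n : ℝ) * Real.log n - 5 * n ≤ 2 * Real.log (h.factorial : ℝ) := by
  have hpos : (0:ℝ) < h := by exact_mod_cast hh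
  have hh1 : (1:ℝ) ≤ h := by exact_mod_cast hh
  have hn1 : (n:ℝ) ≤ 2 * h + 2 := by exact_mod_cast h1
  have hn2 : 2 * (h:ℝ) ≤ n := by exact_mod_cast h2
  have hnpos : (0:ℝ) < n := by linarith
  have hfac : (0:ℝ) < (h.factorial : ℝ) := by exact_mod_cast h.factorial_pos
  have a1 : (h:ℝ) * Real.log h - h ≤ Real.log (h.factorial : ℝ) := by
    have := Real.pow_div_factorial_le_exp (h:ℝ) hpos.le h
    have := Real.log_le_log (by positivity) this
    rw [Real.log_exp, Real.log_div (by positivity) (by positivity), Real.log_pow] at this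
    linarith
  have a2 : Real.log n ≤ 3 + Real.log h := by
    have e1 : Real.log n ≤ Real.log (4 * h) := Real.log_le_log hnpos (by linarith)
    rw [Real.log_mul (by norm_num) (by positivity)] at e1
    have e2 := Real.log_le_sub_one_of_pos (show (0:ℝ) < 4 by norm_num)
    linarith
  have a3 : Real.log h ≤ h := by
    have := Real.log_le_sub_one_of_pos hpos
    linarith
  have a4 : 0 ≤ Real.log h := Real.log_nonneg hh1
  have a5 : (n:ℝ) * Real.log n ≤ n * (3 + Real.log h) := by gcongr
  have a6 : (n:ℝ) * Real.log h ≤ (2 * h + 2) * Real.log h := by gcongr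
  nlinarith


/-- Let `1 ≤ d₁ < d`.  There is a constant `C > 0` (depending only on `d`
and `d₁`) such that for every `n ≥ 1`, the number `S_n` of marked admissible proper systems
with parameters `m = n(2d - d₁)`, `σ(i) = min(i, m - i, n(d - d₁))`, consisting of exactly
`n(2d - d₁) - 1` intervals, satisfies `log S_n ≥ (4d - 2d₁) n log n - C n`. -/
theorem statement4 (d d₁ : ℕ) (hd₁ : 1 ≤ d₁) (hd : d₁ < d) :
    ∃ C : ℝ, 0 < C ∧ ∀ n : ℕ, 1 ≤ n →
      (4 * (d : ℝ) - 2 * d₁) * n * Real.log n - C * n ≤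
        Real.log (Set.ncard {M : Multiset ((ℤ × ℤ) × ℤ) |
          IsMarkedSystem (n * (2 * d - d₁))
            (fun i : ℤ =>
              (min (min i ((n * (2 * d - d₁) : ℕ) - i)) ((n : ℤ) * (d - d₁ : ℕ))).toNat)
            (n * (2 * d - d₁) - 1) M}) := by

  obtain ⟨e, rfl⟩ : ∃ e, d = d₁ + e := ⟨d - d₁, by omega⟩
  have he : 1 ≤ e := by omega
  have hD : 2 * (d₁ + e) - d₁ = 2 * e + d₁ := by omega
  have hE : d₁ + e - d₁ = e := by omega
  rw [hD, hE]
  set D : ℝ := 2 * e + d₁ with hDdef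
  have hDe : 4 * ((d₁ + e : ℕ) : ℝ) - 2 * d₁ = 2 * D := by rw [hDdef]; push_cast; ring
  rw [hDe]
  have hDpos : 0 < D := by
    have : (1:ℝ) ≤ e := by exact_mod_cast he
    have : (0:ℝ) ≤ d₁ := by positivity
    rw [hDdef]; linarith
  refine ⟨10 * D, by positivity, ?_⟩
  intro n hn
  have hnpos : (0:ℝ) < n := by exact_mod_cast hn
  by_cases hsmall : n ≤ 2
  · refine le_trans ?_ (Real.log_natCast_nonneg _)
    have h1 := Real.log_le_sub_one_of_pos hnpos
    have h2 : (n:ℝ) ≤ 2 := by exact_mod_cast hsmall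
    have : 0 < D * n := by positivity
    nlinarith
  · set h := (n - 1) / 2 with hh
    set r := n - 2 * h with hr
    have hh1 : 1 ≤ h := by omega
    have hr1 : 1 ≤ r := by omega
    have hnr : n = 2 * h + r := by omega
    have hmain := inst_count (2 * e) (2 * d₁) h (e * r) (d₁ * r) (by omega) (by omega) hh1
      (Nat.mul_pos he hr1) (Nat.mul_pos hd₁ hr1) (n * e) (n * d₁) (by rw [hnr]; ring)
      (by rw [hnr]; ring)
    have hm : 2 * (n * e) + n * d₁ = n * (2 * e + d₁) := by ring
    rw [hm] at hmain
    rw [Nat.cast_mul n e] at hmain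
    have hlog := log_factorial_aux n h hh1 (by omega) (by omega)
    have hfac : (0:ℝ) < (h.factorial : ℝ) := by exact_mod_cast h.factorial_pos
    have h3 : 4 * D * Real.log (h.factorial : ℝ) =
        Real.log (((h.factorial * h.factorial) ^ (2 * e + 2 * d₁ + 2 * e) : ℕ) : ℝ) := by
      push_cast
      rw [Real.log_pow, Real.log_mul hfac.ne' hfac.ne', hDdef]
      push_cast; ring
    have h4 : Real.log (((h.factorial * h.factorial) ^ (2 * e + 2 * d₁ + 2 * e) : ℕ) : ℝ) ≤ _ :=
      Real.log_le_log (by exact_mod_cast pow_pos (Nat.mul_pos h.factorial_pos h.factorial_pos) _)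
        (Nat.cast_le.2 hmain)
    refine le_trans ?_ h4
    rw [← h3]
    nlinarith
end
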